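/- arXiv:2003.14362 — 6 statements merged into one kernel-verified Lean document; each statement's English description precedes it below -/
import Mathlib

section
/- Let n ≥ 2 and let A be a real symmetric n×n matrix. If there exist indices r ≠ s with A r s ≠ 0, then there exists a real orthogonal n×n matrix U such that Λ(Uᵀ * A * U) < Λ(A). -/
open Matrix

/-- `Λ(A)`: the sum of the squares of the off-diagonal entries of `A`. -/
noncomputable def offDiagSq {n : ℕ} (A : Matrix (Fin n) (Fin n) ℝ) : ℝ :=
  ∑ i, ∑ j, if i ≠ j then (A i j) ^ 2 else 0

theorem offDiagSq_diagonal {n : ℕ} (d : Fin n → ℝ) : offDiagSq (diagonal d) = 0 := by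
  refine Finset.sum_eq_zero fun i _ => Finset.sum_eq_zero fun j _ => ?_
  split_ifs with h
  · simp [diagonal_apply_ne d h]
  · rfl

theorem offDiagSq_pos {n : ℕ} {A : Matrix (Fin n) (Fin n) ℝ} {r s : Fin n} (hrs : r ≠ s)
    (hArs : A r s ≠ 0) : 0 < offDiagSq A := by
  have h0 : ∀ i j, 0 ≤ if i ≠ j then (A i j) ^ 2 else 0 := fun i j => by
    split_ifs <;> positivity
  refine Finset.sum_pos' (fun i _ => Finset.sum_nonneg fun j _ => h0 i j)
    ⟨r, Finset.mem_univ r, Finset.sum_pos' (fun j _ => h0 r j) ⟨s, Finset.mem_univ s, ?_⟩⟩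
  rw [if_pos hrs]
  positivity

theorem exists_orthogonal_conj_eq_diagonal {n : ℕ} {A : Matrix (Fin n) (Fin n) ℝ} (hA : Aᵀ = A) :
    ∃ (U : Matrix (Fin n) (Fin n) ℝ) (d : Fin n → ℝ), Uᵀ * U = 1 ∧ Uᵀ * A * U = diagonal d := by
  have hH : A.IsHermitian := by rwa [IsHermitian, conjTranspose_eq_transpose_of_trivial]
  refine ⟨hH.eigenvectorUnitary, hH.eigenvalues, ?_, ?_⟩
  · have h := Unitary.coe_star_mul_self hH.eigenvectorUnitary
    rwa [star_eq_conjTranspose, conjTranspose_eq_transpose_of_trivial] at h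
  · have h := hH.conjStarAlgAut_star_eigenvectorUnitary
    rw [Unitary.conjStarAlgAut_star_apply, star_eq_conjTranspose,
      conjTranspose_eq_transpose_of_trivial] at h
    exact h

theorem stmt_2 (n : ℕ) (hn : 2 ≤ n) (A : Matrix (Fin n) (Fin n) ℝ) (hA : Aᵀ = A)
    (r s : Fin n) (hrs : r ≠ s) (hArs : A r s ≠ 0) :
    ∃ U : Matrix (Fin n) (Fin n) ℝ, Uᵀ * U = 1 ∧
      offDiagSq (Uᵀ * A * U) < offDiagSq A := by
  obtain ⟨U, d, hU, hd⟩ := exists_orthogonal_conj_eq_diagonal hA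
  refine ⟨U, hU, ?_⟩
  rw [hd, offDiagSq_diagonal]
  exact offDiagSq_pos hrs hArs
end

section
/- Let n ≥ 1. Every element A of O(n) is joined by a continuous path inside O(n) either to the identity matrix or to the matrix I⁻. That is, for every A ∈ O(n), Joined A 1 or Joined A I⁻ holds in the topological space O(n); consequently O(n) has at most two path components. -/
open Matrix

/-- The matrix `I⁻ = diag(1, …, 1, −1)` (all diagonal entries `1` except the last, `−1`). -/
noncomputable def Iminus (n : ℕ) : Matrix (Fin n) (Fin n) ℝ :=
  Matrix.diagonal fun i => if (i : ℕ) = n - 1 then (-1 : ℝ) else 1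

theorem Iminus_orth (n : ℕ) : (Iminus n)ᵀ * Iminus n = 1 := by
  ext i j
  rw [Iminus, Matrix.diagonal_transpose, Matrix.diagonal_mul_diagonal]
  by_cases hij : i = j
  · subst hij
    by_cases h : (i : ℕ) = n - 1 <;>
      simp [Matrix.diagonal_apply_eq, Matrix.one_apply, h]
  · simp [Matrix.diagonal_apply_ne _ hij, Matrix.one_apply, hij]

namespace Matrix

variable {ι : Type*} [Fintype ι] [DecidableEq ι]

/-- The Householder matrix `1 - 2 v vᵀ / (v ⬝ᵥ v)` of the reflection in the hyperplane orthogonal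
to `v`; it is the identity matrix when `v = 0`. -/
noncomputable def householder (v : ι → ℝ) : Matrix ι ι ℝ :=
  1 - (2 / (v ⬝ᵥ v)) • vecMulVec v v

theorem householder_zero : householder (0 : ι → ℝ) = 1 := by
  simp [householder]

theorem householder_neg (v : ι → ℝ) : householder (-v) = householder v := by
  simp [householder]

theorem householder_transpose_mul_self (v : ι → ℝ) :
    (householder v)ᵀ * householder v = 1 := by
  rcases eq_or_ne v 0 with rfl | hv
  · simp [householder_zero]
  have hv' : v ⬝ᵥ v ≠ 0 := by simpa using hv
  have hsq : vecMulVec v v * vecMulVec v v = (v ⬝ᵥ v) • vecMulVec v v := by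
    rw [vecMulVec_mul_vecMulVec, vecMulVec_smul]
  have htr : (householder v)ᵀ = householder v := by
    simp [householder, transpose_vecMulVec]
  rw [htr, householder, sub_mul, one_mul, mul_sub, mul_one, smul_mul_smul_comm, hsq, smul_smul,
    sub_sub, ← sub_eq_zero]
  have : 2 / (v ⬝ᵥ v) * (2 / (v ⬝ᵥ v)) * (v ⬝ᵥ v) = 2 / (v ⬝ᵥ v) + 2 / (v ⬝ᵥ v) := by
    field_simp
    norm_num
  rw [this]
  module

theorem reflection_apply_eq_householder_mulVec (v x : EuclideanSpace ℝ ι) :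
    (ℝ ∙ v)ᗮ.reflection x = WithLp.toLp 2 (householder v.ofLp *ᵥ x.ofLp) := by
  rw [Submodule.reflection_orthogonal_apply, Submodule.reflection_singleton_apply]
  have hvv : ‖v‖ ^ 2 = v.ofLp ⬝ᵥ v.ofLp := by
    rw [EuclideanSpace.real_norm_sq_eq]
    simp [dotProduct, sq]
  have hvx : inner ℝ v x = v.ofLp ⬝ᵥ x.ofLp := by
    simp [EuclideanSpace.inner_eq_star_dotProduct, dotProduct_comm]
  ext i
  simp [householder, sub_mulVec, smul_mulVec, vecMulVec_mulVec, hvv, hvx]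
  ring

theorem exists_eq_prod_householder {A : Matrix ι ι ℝ} (hA : Aᵀ * A = 1) :
    ∃ l : List (ι → ℝ), A = (l.map householder).prod := by
  have hinner (x y : EuclideanSpace ℝ ι) :
      inner ℝ (toEuclideanLin A x) (toEuclideanLin A y) = inner ℝ x y := by
    simp only [EuclideanSpace.inner_eq_star_dotProduct, ofLp_toLpLin, toLin'_apply, star_trivial]
    rw [dotProduct_mulVec, ← mulVec_transpose, mulVec_mulVec, hA, one_mulVec]
  obtain ⟨l, -, hl⟩ := LinearIsometryEquiv.reflections_generate_dim
    (((toEuclideanLin A).isometryOfInner hinner).toLinearIsometryEquiv rfl)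
  have hprod (m : List (EuclideanSpace ℝ ι)) (x : EuclideanSpace ℝ ι) :
      (m.map fun v => (ℝ ∙ v)ᗮ.reflection).prod x =
        WithLp.toLp 2 (((m.map WithLp.ofLp).map householder).prod *ᵥ x.ofLp) := by
    induction m with
    | nil => simp
    | cons v m ih =>
      simp only [List.map_cons, List.prod_cons, LinearIsometryEquiv.coe_mul, Function.comp_apply,
        ih, reflection_apply_eq_householder_mulVec, mulVec_mulVec]
  refine ⟨l.map WithLp.ofLp, mulVec_injective (funext fun x => ?_)⟩
  have h := hprod l (WithLp.toLp 2 x)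
  rw [← hl] at h
  exact congrArg WithLp.ofLp h

theorem joinedIn_householder {v w : ι → ℝ} (hv : v ≠ 0) (hw : w ≠ 0) :
    JoinedIn {A : Matrix ι ι ℝ | Aᵀ * A = 1} (householder v) (householder w) := by
  wlog hvw : 0 ≤ v ⬝ᵥ w generalizing w
  · rw [← householder_neg w]
    exact this (neg_ne_zero.mpr hw) (by rw [dotProduct_neg]; linarith)
  have hv' : 0 < v ⬝ᵥ v := by simpa using dotProduct_star_self_pos_iff.mpr hv
  have hw' : 0 < w ⬝ᵥ w := by simpa using dotProduct_star_self_pos_iff.mpr hw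
  refine JoinedIn.ofLine (f := fun t => householder ((1 - t) • v + t • w)) ?_ (by simp) (by simp) ?_
  · have hne : ∀ t ∈ unitInterval,
        ((1 - t) • v + t • w) ⬝ᵥ ((1 - t) • v + t • w) ≠ 0 := by
      rintro t ⟨h0, h1⟩
      simp only [add_dotProduct, dotProduct_add, smul_dotProduct, dotProduct_smul, smul_eq_mul,
        dotProduct_comm w v]
      have h2 : 0 ≤ (1 - t) * (t * (v ⬝ᵥ w)) :=
        mul_nonneg (by linarith) (mul_nonneg h0 hvw)
      rcases h0.eq_or_lt with rfl | h0
      · simpa using hv'.ne'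
      · have h3 : 0 < t * (t * (w ⬝ᵥ w)) := by positivity
        have h4 : 0 ≤ (1 - t) * ((1 - t) * (v ⬝ᵥ v)) := by
          rw [← mul_assoc]
          positivity
        linarith
    unfold householder
    refine continuousOn_const.sub (ContinuousOn.smul (continuousOn_const.div ?_ hne) ?_)
    · exact Continuous.continuousOn (by fun_prop)
    · exact Continuous.continuousOn (by fun_prop)
  · rintro _ ⟨t, -, rfl⟩
    exact householder_transpose_mul_self _

theorem joinedIn_mul {A B C D : Matrix ι ι ℝ}
    (hAB : JoinedIn {A : Matrix ι ι ℝ | Aᵀ * A = 1} A B)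
    (hCD : JoinedIn {A : Matrix ι ι ℝ | Aᵀ * A = 1} C D) :
    JoinedIn {A : Matrix ι ι ℝ | Aᵀ * A = 1} (A * C) (B * D) := by
  refine (hAB.mul hCD).mono ?_
  rintro _ ⟨P, hP, Q, hQ, rfl⟩
  rw [Set.mem_ofPred_eq] at hP hQ ⊢
  rw [transpose_mul, Matrix.mul_assoc, ← Matrix.mul_assoc Pᵀ, hP, Matrix.one_mul, hQ]

/-- Every orthogonal matrix is joined inside the orthogonal group either to the identity or to any
prescribed Householder reflection. -/
theorem joinedIn_one_or_householder {A : Matrix ι ι ℝ} (hA : Aᵀ * A = 1) {w : ι → ℝ}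
    (hw : w ≠ 0) :
    JoinedIn {A : Matrix ι ι ℝ | Aᵀ * A = 1} A 1 ∨
      JoinedIn {A : Matrix ι ι ℝ | Aᵀ * A = 1} A (householder w) := by
  obtain ⟨l, rfl⟩ := exists_eq_prod_householder hA
  clear hA
  induction l with
  | nil => exact .inl (JoinedIn.refl (by simp))
  | cons v l ih =>
    rw [List.map_cons, List.prod_cons]
    rcases eq_or_ne v 0 with rfl | hv
    · simpa only [householder_zero, one_mul] using ih
    · have hvw := joinedIn_householder hv hw
      rcases ih with h | h
      · exact .inr (by simpa only [mul_one] using joinedIn_mul hvw h)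
      · have hsq : householder w * householder w = 1 := by
          simpa [householder, transpose_vecMulVec] using householder_transpose_mul_self w
        exact .inl (by simpa only [hsq] using joinedIn_mul hvw h)

end Matrix

theorem householder_single_last_eq_Iminus {n : ℕ} (k : Fin n) (hk : (k : ℕ) = n - 1) :
    householder (Pi.single k 1) = Iminus n := by
  ext i j
  have hik : (i : ℕ) = n - 1 ↔ i = k := by rw [← hk, Fin.ext_iff]
  simp only [householder, Iminus, Matrix.sub_apply, Matrix.smul_apply, vecMulVec_apply, diagonal_apply,
    one_apply, hik, Pi.single_apply, dotProduct_single, smul_eq_mul]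
  split_ifs <;> grind

theorem stmt_8 (n : ℕ) (hn : 1 ≤ n)
    (A : {A : Matrix (Fin n) (Fin n) ℝ // Aᵀ * A = 1}) :
    Joined A ⟨1, by simp⟩ ∨ Joined A ⟨Iminus n, Iminus_orth n⟩ := by
  let k : Fin n := ⟨n - 1, by lia⟩
  have h := joinedIn_one_or_householder A.2 (w := Pi.single k 1) (by simp)
  rw [householder_single_last_eq_Iminus k rfl] at h
  exact h.imp JoinedIn.joined_subtype JoinedIn.joined_subtype
end

section
/- Let n ≥ 1. The map Φ : V_{n,n} → V_{n,n−1} that sends an orthonormal n-frame (v₁, …, vₙ) in ℝⁿ to the (n−1)-frame (v₁, …, v_{n−1}) obtained by deleting its final vector is a covering map, and every fiber Φ⁻¹(q) has exactly two elements. -/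
/-- Deletion of the final vector of an orthonormal `n`-frame in `ℝⁿ`,
as a map `V_{n,n} → V_{n,n−1}` of compact Stiefel manifolds. -/
noncomputable def deleteLast (n : ℕ) :
    {f : Fin n → EuclideanSpace ℝ (Fin n) // Orthonormal ℝ f} →
    {g : Fin (n - 1) → EuclideanSpace ℝ (Fin n) // Orthonormal ℝ g} :=
  fun f => ⟨f.1 ∘ Fin.castLE (Nat.sub_le n 1),
    f.2.comp _ (Fin.castLE_injective _)⟩

open Module Topology

section Orthonormal

variable {ι E : Type*} [DecidableEq ι] [NormedAddCommGroup E] [InnerProductSpace ℝ E]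

theorem Orthonormal.update_units_smul {f : ι → E} (hf : Orthonormal ℝ f) (i : ι) (u : ℤˣ) :
    Orthonormal ℝ (Function.update f i (u • f i)) := by
  rcases Int.units_eq_one_or u with rfl | rfl
  · simpa using hf
  · refine ⟨fun j => ?_, fun j k hjk => ?_⟩
    · obtain rfl | hj := eq_or_ne j i
      · simpa [Units.smul_def] using hf.1 j
      · simpa [hj] using hf.1 j
    · obtain rfl | hj := eq_or_ne j i
      · simpa [Units.smul_def, hjk.symm] using hf.2 hjk
      · obtain rfl | hk := eq_or_ne k i
        · simpa [Units.smul_def, hj] using hf.2 hjk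
        · simpa [hj, hk] using hf.2 hjk

/-- The group `{1, -1}` acts on orthonormal families by changing the sign of the `i`-th vector. -/
abbrev orthonormalSignAction (E : Type*) [NormedAddCommGroup E] [InnerProductSpace ℝ E] (i : ι) :
    MulAction ℤˣ {f : ι → E // Orthonormal ℝ f} where
  smul u f := ⟨Function.update f.1 i (u • f.1 i), f.2.update_units_smul i u⟩
  one_smul f := Subtype.ext <| by
    change Function.update f.1 i ((1 : ℤˣ) • f.1 i) = f.1
    simp
  mul_smul u v f := Subtype.ext <| by
    change Function.update f.1 i ((u * v) • f.1 i) =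
      Function.update (Function.update f.1 i (v • f.1 i)) i
        (u • Function.update f.1 i (v • f.1 i) i)
    simp [mul_smul]

omit [DecidableEq ι] in
/-- Two orthonormal bases that agree away from one index agree up to sign at that index. -/
theorem Orthonormal.exists_units_smul_eq_of_forall_ne [Fintype ι] [FiniteDimensional ℝ E]
    (hE : finrank ℝ E = Fintype.card ι) {f g : ι → E} (hf : Orthonormal ℝ f)
    (hg : Orthonormal ℝ g) (i : ι) (hfg : ∀ j ≠ i, f j = g j) :
    ∃ u : ℤˣ, u • g i = f i := by
  obtain ⟨b, hb⟩ := Orthonormal.exists_orthonormalBasis_extension_of_card_eq hE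
    (v := g) (s := Set.univ) (hg.comp _ Subtype.val_injective)
  have hsum : inner ℝ (g i) (f i) • g i = f i := by
    have hrepr := b.sum_repr' (f i)
    rw [Finset.sum_eq_single i, hb i trivial] at hrepr
    · exact hrepr
    · intro j _ hj
      rw [hb j trivial, ← hfg j hj, hf.2 hj, zero_smul]
    · simp
  have hnorm : |inner ℝ (g i) (f i)| = 1 := by
    simpa [norm_smul, hf.1 i, hg.1 i] using congrArg norm hsum
  rcases (abs_eq zero_le_one).1 hnorm with h | h
  · exact ⟨1, by simpa [h] using hsum⟩
  · exact ⟨-1, by simpa [h, Units.smul_def] using hsum⟩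

omit [DecidableEq ι] in
theorem isClosed_setOf_orthonormal : IsClosed {f : ι → E | Orthonormal ℝ f} := by
  simp only [Orthonormal, Set.ofPred_and, Set.ofPred_forall, Pairwise]
  refine (isClosed_iInter fun i => isClosed_eq (by fun_prop) (by fun_prop)).inter ?_
  exact isClosed_iInter fun i => isClosed_iInter fun j => isClosed_iInter fun _ =>
    isClosed_eq (by fun_prop) (by fun_prop)

omit [DecidableEq ι] in
theorem isCompact_setOf_orthonormal [ProperSpace E] :
    IsCompact {f : ι → E | Orthonormal ℝ f} :=
  (isCompact_univ_pi fun _ : ι => isCompact_closedBall (0 : E) 1).of_isClosed_subset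
    isClosed_setOf_orthonormal fun f hf i _ => by simp [hf.1 i]

end Orthonormal

theorem continuous_deleteLast (n : ℕ) : Continuous (deleteLast n) := by
  refine Continuous.subtype_mk ?_ _
  exact continuous_pi fun i => (continuous_apply _).comp continuous_subtype_val

theorem deleteLast_surjective (n : ℕ) : Function.Surjective (deleteLast n) := by
  intro q
  set c : Fin (n - 1) → Fin n := Fin.castLE (Nat.sub_le n 1)
  have hc : Function.Injective c := Fin.castLE_injective _
  have hv (j) : Function.extend c q.1 0 (c j) = q.1 j := hc.extend_apply _ _ _
  have horth : Orthonormal ℝ ((Set.range c).domRestrict (Function.extend c q.1 0)) := by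
    convert q.2.comp _ (Equiv.ofInjective c hc).symm.injective using 1
    funext x
    obtain ⟨j, rfl⟩ := (Equiv.ofInjective c hc).surjective x
    simpa using hv j
  obtain ⟨b, hb⟩ := horth.exists_orthonormalBasis_extension_of_card_eq (by simp)
  exact ⟨⟨b, b.orthonormal⟩, Subtype.ext <| funext fun j => (hb _ ⟨j, rfl⟩).trans (hv j)⟩

theorem deleteLast_eq_iff {m : ℕ}
    {f g : {f : Fin (m + 1) → EuclideanSpace ℝ (Fin (m + 1)) // Orthonormal ℝ f}} :
    deleteLast (m + 1) f = deleteLast (m + 1) g ↔ ∀ j ≠ Fin.last m, f.1 j = g.1 j := by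
  refine ⟨fun h j hj => ?_, fun h => Subtype.ext <| funext fun j => h _ (Fin.castSucc_ne_last j)⟩
  obtain ⟨k, rfl⟩ := Fin.exists_castSucc_eq.2 hj
  exact congrFun (congrArg Subtype.val h) k

theorem isQuotientCoveringMap_deleteLast (m : ℕ) :
    letI := orthonormalSignAction (EuclideanSpace ℝ (Fin (m + 1))) (Fin.last m)
    IsQuotientCoveringMap (deleteLast (m + 1)) ℤˣ := by
  let := orthonormalSignAction (EuclideanSpace ℝ (Fin (m + 1))) (Fin.last m)
  have smul_val (u : ℤˣ)
      (f : {f : Fin (m + 1) → EuclideanSpace ℝ (Fin (m + 1)) // Orthonormal ℝ f}) :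
      (u • f).1 = Function.update f.1 (Fin.last m) (u • f.1 (Fin.last m)) := rfl
  have : CompactSpace {f : Fin (m + 1) → EuclideanSpace ℝ (Fin (m + 1)) // Orthonormal ℝ f} :=
    isCompact_iff_compactSpace.1 isCompact_setOf_orthonormal
  have : ContinuousConstSMul ℤˣ
      {f : Fin (m + 1) → EuclideanSpace ℝ (Fin (m + 1)) // Orthonormal ℝ f} := by
    refine ⟨fun u => Continuous.subtype_mk (continuous_subtype_val.update _ ?_) _⟩
    simp only [Units.smul_def]
    exact ((continuous_apply _).comp continuous_subtype_val).const_smul _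
  have : ProperlyDiscontinuousSMul ℤˣ
      {f : Fin (m + 1) → EuclideanSpace ℝ (Fin (m + 1)) // Orthonormal ℝ f} :=
    ⟨fun _ _ => Set.toFinite _⟩
  have : IsCancelSMul ℤˣ
      {f : Fin (m + 1) → EuclideanSpace ℝ (Fin (m + 1)) // Orthonormal ℝ f} := by
    refine isCancelSMul_iff_eq_one_of_smul_eq.2 fun u f h => ?_
    refine (Int.units_eq_one_or u).resolve_right ?_
    rintro rfl
    have := IsAddTorsionFree.of_isTorsionFree ℝ (EuclideanSpace ℝ (Fin (m + 1)))
    have h' := congrFun (congrArg Subtype.val h) (Fin.last m)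
    rw [smul_val, Function.update_self, Units.neg_smul, one_smul] at h'
    exact f.2.ne_zero _ (self_eq_neg.1 h'.symm)
  refine IsQuotientMap.isQuotientCoveringMap_of_properlyDiscontinuousSMul
    ((continuous_deleteLast _).isClosedMap.isQuotientMap (continuous_deleteLast _)
      (deleteLast_surjective _)) fun {f g} => ?_
  rw [deleteLast_eq_iff]
  constructor
  · intro h
    obtain ⟨u, hu⟩ := f.2.exists_units_smul_eq_of_forall_ne (by simp) g.2 (Fin.last m) h
    refine ⟨u, Subtype.ext <| (smul_val u g).trans ?_⟩
    rw [hu, Function.update_eq_iff]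
    exact ⟨rfl, fun j hj => (h j hj).symm⟩
  · rintro ⟨u, rfl⟩ j hj
    exact (congrFun (smul_val u g) j).trans (Function.update_of_ne hj _ _)

theorem stmt_9 (n : ℕ) (hn : 1 ≤ n) :
    IsCoveringMap (deleteLast n) ∧
    ∀ q : {g : Fin (n - 1) → EuclideanSpace ℝ (Fin n) // Orthonormal ℝ g},
      Nat.card (deleteLast n ⁻¹' {q}) = 2 := by
  obtain ⟨m, rfl⟩ := Nat.exists_eq_add_of_le' hn
  let := orthonormalSignAction (EuclideanSpace ℝ (Fin (m + 1))) (Fin.last m)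
  have hcov := isQuotientCoveringMap_deleteLast m
  refine ⟨hcov.isCoveringMap, fun q => ?_⟩
  obtain ⟨f, hf⟩ := deleteLast_surjective (m + 1) q
  rw [Nat.card_congr (hcov.fiberEquivGroup ⟨f, hf⟩), Nat.card_eq_fintype_card,
    Fintype.card_units_int]
end

section
/- Let n ≥ 3. There is no continuous path in O(n) from the identity matrix to the matrix I⁻: ¬ Joined 1 I⁻ holds in the topological space O(n). In particular, O(n) is not path-connected, while its image V_{n,n−1} under deletion of the last frame vector is path-connected. -/
open Matrix

theorem det_Iminus {n : ℕ} (hn : n ≠ 0) : (Iminus n).det = -1 := by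
  obtain ⟨m, rfl⟩ := Nat.exists_eq_succ_of_ne_zero hn
  rw [Iminus, Matrix.det_diagonal, Fin.prod_univ_castSucc]
  have h (i : Fin m) : (i : ℕ) ≠ m := i.isLt.ne
  simp [h]

/-- The determinant is constant along paths of orthogonal matrices. -/
theorem Joined.det_eq_one {ι : Type*} [Fintype ι] [DecidableEq ι]
    {A B : {A : Matrix ι ι ℝ // Aᵀ * A = 1}} (h : Joined A B) (hA : A.1.det = 1) :
    B.1.det = 1 := by
  have hsq (C : {A : Matrix ι ι ℝ // Aᵀ * A = 1}) : C.1.det * C.1.det = 1 := by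
    simpa using congrArg Matrix.det C.2
  rcases mul_self_eq_one_iff.mp (hsq B) with hB | hB
  · exact hB
  obtain ⟨γ⟩ := h
  have hcont : Continuous fun t => (γ t).1.det :=
    (continuous_subtype_val.comp γ.continuous).matrix_det
  obtain ⟨t, ht⟩ := mem_range_of_exists_le_of_exists_ge (c := (0 : ℝ)) hcont
    ⟨1, by simp [hB]⟩ ⟨0, by simp [hA]⟩
  simpa [ht] using hsq (γ t)

theorem reflection_orthogonal_singleton_apply {E : Type*} [NormedAddCommGroup E]
    [InnerProductSpace ℝ E] (u x : E) :
    (ℝ ∙ u)ᗮ.reflection x = x - (2 * (inner ℝ u x / ‖u‖ ^ 2)) • u := by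
  rw [Submodule.reflection_orthogonal_apply, Submodule.reflection_singleton_apply]
  simp [two_smul, two_mul, add_smul]

section Stiefel

variable {ι E : Type*} [Fintype ι] [NormedAddCommGroup E] [InnerProductSpace ℝ E]
  [FiniteDimensional ℝ E]

theorem Orthonormal.exists_orthonormalBasis_sum {k : ℕ} {f : ι → E} (hf : Orthonormal ℝ f)
    (hk : Module.finrank ℝ E = Fintype.card ι + k) :
    ∃ b : OrthonormalBasis (ι ⊕ Fin k) ℝ E, ∀ i, b (Sum.inl i) = f i := by
  let e := (Equiv.ofInjective (Sum.inl : ι → ι ⊕ Fin k) Sum.inl_injective).symm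
  have hv : Orthonormal ℝ ((Set.range Sum.inl).domRestrict (Sum.elim f (0 : Fin k → E))) := by
    convert hf.comp e e.injective using 1
    ext ⟨_, i, rfl⟩
    simp [e, Set.domRestrict]
  obtain ⟨b, hb⟩ := hv.exists_orthonormalBasis_extension_of_card_eq (by simpa using hk)
  exact ⟨b, fun i => by simpa using hb (Sum.inl i) ⟨i, rfl⟩⟩

/-- A linear isometry maps orthonormal families to orthonormal families. -/
def orthonormalMap (φ : E ≃ₗᵢ[ℝ] E) (f : {f : ι → E // Orthonormal ℝ f}) :
    {f : ι → E // Orthonormal ℝ f} :=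
  ⟨φ ∘ f.1, f.2.comp_linearIsometryEquiv φ⟩

/-- If the frame `f` is not a basis, moving the mirror from a vector orthogonal to `f` to a given
vector `v` joins `f` to its reflection. -/
theorem joined_reflection (hE : Fintype.card ι < Module.finrank ℝ E)
    (f : {f : ι → E // Orthonormal ℝ f}) (v : E) :
    Joined f (orthonormalMap (ℝ ∙ v)ᗮ.reflection f) := by
  by_cases hv : v = 0
  · subst hv
    convert Joined.refl f
    ext i
    simp only [orthonormalMap, Function.comp_apply, reflection_orthogonal_singleton_apply, smul_zero,
      sub_zero]
  obtain ⟨k, hk⟩ := Nat.exists_eq_add_of_lt hE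
  obtain ⟨b, hb⟩ := f.2.exists_orthonormalBasis_sum (k := k + 1) (by omega)
  obtain hι | hι := isEmpty_or_nonempty ι
  · convert Joined.refl f
    ext i
    exact isEmptyElim i
  have hrank : 1 < Module.rank ℝ E := by
    have := Fintype.card_pos (α := ι)
    rw [← Module.finrank_eq_rank]
    exact_mod_cast (by omega : 1 < Module.finrank ℝ E)
  obtain ⟨γ, hγ⟩ := (isPathConnected_compl_singleton_of_one_lt_rank hrank (0 : E)).joinedIn
    (b (Sum.inr 0)) (b.orthonormal.ne_zero _) v hv
  refine ⟨⟨⟨fun t => orthonormalMap (ℝ ∙ γ t)ᗮ.reflection f, ?_⟩, ?_, ?_⟩⟩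
  · refine Continuous.subtype_mk (continuous_pi fun i => ?_) _
    have hne (t) : ‖γ t‖ ^ 2 ≠ 0 := by simpa using hγ t
    have hγc := γ.continuous
    simp only [Function.comp_apply, reflection_orthogonal_singleton_apply]
    fun_prop (disch := assumption)
  · ext i
    have : inner ℝ (b (Sum.inr 0)) (b (Sum.inl i)) = 0 := b.orthonormal.2 (by simp)
    rw [hb] at this
    simp [orthonormalMap, reflection_orthogonal_singleton_apply, this]
  · simp

theorem joined_orthonormalMap (hE : Fintype.card ι < Module.finrank ℝ E)
    (φ : E ≃ₗᵢ[ℝ] E) (f : {f : ι → E // Orthonormal ℝ f}) : Joined f (orthonormalMap φ f) := by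
  have hφ : φ ∈ Subgroup.closure (Set.range fun v : E => (ℝ ∙ v)ᗮ.reflection) := by
    rw [LinearIsometryEquiv.reflections_generate]
    trivial
  induction hφ using Subgroup.closure_induction generalizing f with
  | mem _ h =>
    obtain ⟨v, rfl⟩ := h
    exact joined_reflection hE f v
  | one => exact Joined.refl f
  | mul φ ψ _ _ hφ hψ => exact (hψ f).trans (hφ (orthonormalMap ψ f))
  | inv φ _ hφ =>
    convert (hφ (orthonormalMap φ⁻¹ f)).symm using 1
    ext i
    exact (φ.apply_symm_apply _).symm

theorem pathConnectedSpace_orthonormal (hE : Fintype.card ι < Module.finrank ℝ E) :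
    PathConnectedSpace {f : ι → E // Orthonormal ℝ f} where
  nonempty := by
    obtain ⟨e⟩ := Function.Embedding.nonempty_of_card_le
      (hE.le.trans_eq (Fintype.card_fin (Module.finrank ℝ E)).symm)
    exact ⟨_, (stdOrthonormalBasis ℝ E).orthonormal.comp e e.injective⟩
  joined f g := by
    obtain ⟨k, hk⟩ := Nat.exists_eq_add_of_le hE.le
    obtain ⟨b, hb⟩ := f.2.exists_orthonormalBasis_sum hk
    obtain ⟨c, hc⟩ := g.2.exists_orthonormalBasis_sum hk
    convert joined_orthonormalMap hE (b.equiv c (Equiv.refl _)) f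
    ext i
    simp [orthonormalMap, ← hb, ← hc]

end Stiefel

theorem stmt_11 (n : ℕ) (hn : 3 ≤ n) :
    ¬ Joined (X := {A : Matrix (Fin n) (Fin n) ℝ // Aᵀ * A = 1})
        ⟨1, by simp⟩ ⟨Iminus n, Iminus_orth n⟩ ∧
    ¬ PathConnectedSpace {A : Matrix (Fin n) (Fin n) ℝ // Aᵀ * A = 1} ∧
    PathConnectedSpace
      {f : Fin (n - 1) → EuclideanSpace ℝ (Fin n) // Orthonormal ℝ f} := by
  have h : ¬ Joined (X := {A : Matrix (Fin n) (Fin n) ℝ // Aᵀ * A = 1})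
      ⟨1, by simp⟩ ⟨Iminus n, Iminus_orth n⟩ := by
    intro h
    have := h.det_eq_one (by simp)
    norm_num [det_Iminus (by omega : n ≠ 0)] at this
  exact ⟨h, fun _ => h (PathConnectedSpace.joined _ _),
    pathConnectedSpace_orthonormal (by simp; omega)⟩
end

section
/- Let n ≥ 3. The fundamental group of the compact Stiefel manifold V_{n,n−1} of orthonormal (n−1)-frames in ℝⁿ, based at any point, is isomorphic to the group of two elements ℤ/2ℤ. -/
open Module Submodule unitInterval
open scoped RealInnerProductSpace

section Avoidance

variable {E F : Type*} [NormedAddCommGroup E] [NormedSpace ℝ E] [FiniteDimensional ℝ E]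
  [NormedAddCommGroup F] [NormedSpace ℝ F] [FiniteDimensional ℝ F]

/-- A continuous unit vector field along a low-dimensional space can be perturbed, without ever
becoming antipodal to the original one, so that it avoids the value `-e`. -/
theorem exists_continuous_unit_avoiding (hFE : finrank ℝ F + 1 < finrank ℝ E) {h : F → E}
    (hc : Continuous h) (hn : ∀ x, ‖h x‖ = 1) (e : E) :
    ∃ g : F → E, Continuous g ∧ (∀ x, ‖g x‖ = 1) ∧ (∀ x, h x + g x ≠ 0) ∧ ∀ x, e + g x ≠ 0 := by
  obtain ⟨p, hp, hpd, -⟩ := hc.exists_contDiff_approx 1 (ε := fun _ ↦ 1 / 2) continuous_const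
    (fun _ ↦ by norm_num)
  have hq : ContDiff ℝ 1 (fun z : F × ℝ ↦ -(z.2 • e) - p z.1) := by
    have := hp.comp (contDiff_fst (𝕜 := ℝ) (E := F) (F := ℝ))
    exact ((contDiff_snd.smul contDiff_const).neg).sub this
  have hd := hq.dense_compl_range_of_finrank_lt_finrank (by simpa using hFE)
  obtain ⟨w, hw, hwn⟩ := hd.exists_dist_lt 0 (ε := 1 / 2) (by norm_num)
  rw [dist_zero_left] at hwn
  have hne : ∀ x (t : ℝ), p x + w ≠ -(t • e) := fun x t hxt ↦
    hw ⟨(x, t), by simp [← hxt]⟩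
  have h0 : ∀ x, p x + w ≠ 0 := fun x hx ↦ hne x 0 (by simpa using hx)
  have hpos : ∀ x, 0 < ‖p x + w‖ := fun x ↦ norm_pos_iff.2 (h0 x)
  refine ⟨fun x ↦ ‖p x + w‖⁻¹ • (p x + w), ?_, fun x ↦ ?_, fun x hx ↦ ?_, fun x hx ↦ ?_⟩
  · have : Continuous fun x ↦ p x + w := hp.continuous.add continuous_const
    exact (this.norm.inv₀ fun x ↦ (hpos x).ne').smul this
  · rw [norm_smul, norm_inv, norm_norm, inv_mul_cancel₀ (hpos x).ne']
  · have h1 : p x + w = -(‖p x + w‖ • h x) := by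
      rw [← smul_neg, neg_eq_of_add_eq_zero_right hx, smul_inv_smul₀ (hpos x).ne']
    have h2 : (1 + ‖p x + w‖) • h x = -(p x - h x) - w := by
      rw [add_smul, one_smul]
      linear_combination (norm := module) h1
    have h3 := norm_sub_le (-(p x - h x)) w
    rw [← h2, norm_neg, norm_smul, hn, ← dist_eq_norm, Real.norm_of_nonneg
      (by linarith [hpos x])] at h3
    linarith [hpd x, hpos x]
  · refine hne x ‖p x + w‖ ?_
    rw [← smul_neg, neg_eq_of_add_eq_zero_right hx, smul_inv_smul₀ (hpos x).ne']

end Avoidance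

section Reflection

variable {E : Type*} [NormedAddCommGroup E] [InnerProductSpace ℝ E]

theorem reflection_span_singleton_self (u : E) : reflection (ℝ ∙ u) u = u :=
  reflection_mem_subspace_eq_self (mem_span_singleton_self u)

/-- The half-turn around the bisector of two vectors of equal length exchanges them. -/
theorem reflection_span_add_apply_left {a b : E} (h : ‖a‖ = ‖b‖) (hab : a + b ≠ 0) :
    reflection (ℝ ∙ (a + b)) a = b := by
  have h1 : ‖a + b‖ ^ 2 = 2 * ⟪a + b, a⟫ := by
    rw [← real_inner_self_eq_norm_sq, inner_add_left, inner_add_right, inner_add_right,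
      inner_add_left, real_inner_self_eq_norm_sq b, ← h, real_inner_self_eq_norm_sq a,
      real_inner_comm a b]
    ring
  have h2 : ⟪a + b, a⟫ ≠ 0 := fun h0 ↦ hab (by simpa [h0] using h1)
  rw [reflection_singleton_apply]
  simp only [RCLike.ofReal_real_eq_id, id_eq]
  rw [h1, ← smul_assoc, two_smul, ← two_mul]
  rw [show 2 * (⟪a + b, a⟫ / (2 * ⟪a + b, a⟫)) = 1 by field_simp]
  simp

theorem reflection_span_add_apply_right {a b : E} (h : ‖a‖ = ‖b‖) (hab : a + b ≠ 0) :
    reflection (ℝ ∙ (a + b)) b = a := by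
  simpa using (congrArg (reflection (ℝ ∙ (a + b))) (reflection_span_add_apply_left h hab)).symm

theorem continuous_reflection_span_singleton {X : Type*} [TopologicalSpace X] {u v : X → E}
    (hu : Continuous u) (hv : Continuous v) (h0 : ∀ x, u x ≠ 0) :
    Continuous fun x ↦ reflection (ℝ ∙ u x) (v x) := by
  simp only [reflection_singleton_apply, RCLike.ofReal_real_eq_id, id_eq]
  have : Continuous fun x ↦ ⟪u x, v x⟫ / ‖u x‖ ^ 2 :=
    (hu.inner hv).div (hu.norm.pow 2) fun x ↦ pow_ne_zero 2 (norm_ne_zero_iff.2 (h0 x))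
  exact ((this.smul hu).const_smul 2).sub hv

theorem reflection_span_add_self (u x : E) :
    reflection (ℝ ∙ (u + u)) x = reflection (ℝ ∙ u) x := by
  have h : (ℝ ∙ (u + u)) = ℝ ∙ u := by
    rw [← two_smul ℝ u]
    exact span_singleton_smul_eq (by norm_num) u
  simp only [h]

theorem add_lineMap_ne_zero {u v : E} (hu : ‖u‖ = 1) (hv : ‖v‖ = 1) (huv : u + v ≠ 0) (s : I) :
    u + ((1 - (s : ℝ)) • u + (s : ℝ) • v) ≠ 0 := by
  intro h
  have h1 : (2 - (s : ℝ)) • u = -((s : ℝ) • v) := by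
    linear_combination (norm := module) h
  have h2 := congrArg norm h1
  rw [norm_neg, norm_smul, norm_smul, hu, hv, Real.norm_of_nonneg s.2.1,
    Real.norm_of_nonneg (by linarith [s.2.2])] at h2
  have h3 : (s : ℝ) = 1 := by linarith
  rw [h3] at h
  apply huv
  simpa using h

end Reflection

section Frames

variable {E E' : Type*} [NormedAddCommGroup E] [InnerProductSpace ℝ E]
  [NormedAddCommGroup E'] [InnerProductSpace ℝ E'] {k : ℕ}

/-- The Stiefel manifold of orthonormal `k`-frames in `E`. -/
abbrev OrthonormalFrame (k : ℕ) (E : Type*) [NormedAddCommGroup E] [InnerProductSpace ℝ E] :=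
  {f : Fin k → E // Orthonormal ℝ f}

/-- A linear isometric equivalence acts on orthonormal frames. -/
def OrthonormalFrame.congr (φ : E ≃ₗᵢ[ℝ] E') : OrthonormalFrame k E ≃ₜ OrthonormalFrame k E' where
  toFun f := ⟨φ ∘ f.1, f.2.comp_linearIsometryEquiv φ⟩
  invFun f := ⟨φ.symm ∘ f.1, f.2.comp_linearIsometryEquiv φ.symm⟩
  left_inv f := Subtype.ext <| funext fun i ↦ φ.symm_apply_apply _
  right_inv f := Subtype.ext <| funext fun i ↦ φ.apply_symm_apply _
  continuous_toFun := by
    refine Continuous.subtype_mk (continuous_pi fun i ↦ φ.continuous.comp ?_) _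
    exact (continuous_apply i).comp continuous_subtype_val
  continuous_invFun := by
    refine Continuous.subtype_mk (continuous_pi fun i ↦ φ.symm.continuous.comp ?_) _
    exact (continuous_apply i).comp continuous_subtype_val

/-- Adding the unit vector `e` in front of a frame orthogonal to `e`. -/
def frameCons (k : ℕ) (e : E) (he : ‖e‖ = 1) :
    C(OrthonormalFrame k (ℝ ∙ e)ᗮ, OrthonormalFrame (k + 1) E) where
  toFun g := ⟨Matrix.vecCons e fun i ↦ (g.1 i : E), orthonormal_vecCons_iff.2
    ⟨he, fun i ↦ mem_orthogonal_singleton_iff_inner_right.1 (g.1 i).2,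
      g.2.comp_linearIsometry (ℝ ∙ e)ᗮ.subtypeₗᵢ⟩⟩
  continuous_toFun := by
    refine Continuous.subtype_mk (continuous_pi fun i ↦ ?_) _
    refine Fin.cases continuous_const (fun i ↦ ?_) i
    exact continuous_subtype_val.comp ((continuous_apply i).comp continuous_subtype_val)

theorem frameCons_injective (e : E) (he : ‖e‖ = 1) : Function.Injective (frameCons k e he) := by
  intro f g h
  refine Subtype.ext (funext fun i ↦ Subtype.ext ?_)
  exact congrFun (congrArg Subtype.val h) i.succ

theorem frameCons_apply_zero (e : E) (he : ‖e‖ = 1) (f) : (frameCons k e he f).1 0 = e := rfl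

/-- A continuous family of frames with constant first vector `e` comes from a continuous family of
frames in the orthogonal complement of `e`. -/
theorem exists_frameCons_eq {K : Type*} [TopologicalSpace K] (e : E) (he : ‖e‖ = 1)
    (f : C(K, OrthonormalFrame (k + 1) E)) (hf : ∀ t, (f t).1 0 = e) :
    ∃ g : C(K, OrthonormalFrame k (ℝ ∙ e)ᗮ), ∀ t, frameCons k e he (g t) = f t := by
  have ho : ∀ t i, (f t).1 (Fin.succ i) ∈ (ℝ ∙ e)ᗮ := fun t i ↦ by
    rw [mem_orthogonal_singleton_iff_inner_right, ← hf t]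
    exact (f t).2.2 (Fin.succ_ne_zero i).symm
  have hon : ∀ t, Orthonormal ℝ fun i : Fin k ↦ (⟨(f t).1 i.succ, ho t i⟩ : (ℝ ∙ e)ᗮ) := fun t ↦
    ((ℝ ∙ e)ᗮ.subtypeₗᵢ.orthonormal_comp_iff).1 ((f t).2.comp _ (Fin.succ_injective k))
  refine ⟨⟨fun t ↦ ⟨fun i ↦ ⟨(f t).1 i.succ, ho t i⟩, hon t⟩, ?_⟩, fun t ↦ ?_⟩
  · refine Continuous.subtype_mk (continuous_pi fun i ↦ Continuous.subtype_mk ?_ _) _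
    exact (continuous_apply i.succ).comp (continuous_subtype_val.comp f.continuous)
  · refine Subtype.ext (funext fun i ↦ Fin.cases ?_ (fun _ ↦ rfl) i)
    exact (hf t).symm

variable [FiniteDimensional ℝ E]

/-- A family of frames parametrised by a low-dimensional space can be deformed, keeping fixed the
frames that already have first vector `e`, to a family of frames with first vector `e`. -/
theorem exists_homotopy_first_vector_eq {K F : Type*} [TopologicalSpace K] [NormedAddCommGroup F]
    [NormedSpace ℝ F] [FiniteDimensional ℝ F] (hFE : finrank ℝ F + 1 < finrank ℝ E)
    (ι : C(K, F)) (r : C(F, K)) (hr : ∀ t, r (ι t) = t) (e : E) (he : ‖e‖ = 1)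
    (f : C(K, OrthonormalFrame (k + 1) E)) :
    ∃ Φ : C(I × K, OrthonormalFrame (k + 1) E), (∀ t, Φ (0, t) = f t) ∧
      (∀ t, (Φ (1, t)).1 0 = e) ∧ ∀ s t, (f t).1 0 = e → Φ (s, t) = f t := by
  have hev : ∀ i, Continuous fun t ↦ (f t).1 i := fun i ↦
    (continuous_apply i).comp (continuous_subtype_val.comp f.continuous)
  obtain ⟨g₀, hg₀c, hg₀n, hg₀h, hg₀e⟩ := exists_continuous_unit_avoiding hFE
    (h := fun x ↦ (f (r x)).1 0) ((hev 0).comp r.continuous) (fun x ↦ (f (r x)).2.1 0) e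
  obtain ⟨g, hg, hgn, hgh, hge⟩ : ∃ g : K → E, Continuous g ∧ (∀ t, ‖g t‖ = 1) ∧
      (∀ t, (f t).1 0 + g t ≠ 0) ∧ ∀ t, e + g t ≠ 0 :=
    ⟨fun t ↦ g₀ (ι t), hg₀c.comp ι.continuous, fun t ↦ hg₀n _,
      fun t ↦ by simpa [hr] using hg₀h (ι t), fun t ↦ hg₀e _⟩
  let v (u : E) (z : I × K) : E := u + ((1 - (z.1 : ℝ)) • u + (z.1 : ℝ) • g z.2)
  let A (z : I × K) : E ≃ₗᵢ[ℝ] E :=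
    (((reflection (ℝ ∙ (f z.2).1 0)).trans (reflection (ℝ ∙ v ((f z.2).1 0) z))).trans
      (reflection (ℝ ∙ v e z))).trans (reflection (ℝ ∙ e))
  have hA : ∀ z x, A z x = reflection (ℝ ∙ e) (reflection (ℝ ∙ v e z)
    (reflection (ℝ ∙ v ((f z.2).1 0) z) (reflection (ℝ ∙ (f z.2).1 0) x))) := fun _ _ ↦ rfl
  have hv : ∀ {u : I × K → E}, Continuous u → Continuous fun z ↦ v (u z) z := fun hu ↦ by
    have hs : Continuous fun z : I × K ↦ (z.1 : ℝ) := continuous_subtype_val.comp continuous_fst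
    exact hu.add (((continuous_const.sub hs).smul hu).add (hs.smul (hg.comp continuous_snd)))
  have h0c : Continuous fun z : I × K ↦ (f z.2).1 0 := (hev 0).comp continuous_snd
  have hne : ∀ t, (f t).1 0 ≠ 0 := fun t ↦ (f t).2.ne_zero 0
  have hAc : ∀ i, Continuous fun z : I × K ↦ A z ((f z.2).1 i) := fun i ↦ by
    simp only [hA]
    refine (reflection (ℝ ∙ e)).continuous.comp ?_
    refine continuous_reflection_span_singleton (hv continuous_const) ?_
      fun z ↦ add_lineMap_ne_zero he (hgn _) (hge _) _
    refine continuous_reflection_span_singleton (hv h0c) ?_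
      fun z ↦ add_lineMap_ne_zero ((f z.2).2.1 0) (hgn _) (hgh _) _
    exact continuous_reflection_span_singleton h0c ((hev i).comp continuous_snd) fun z ↦ hne _
  refine ⟨⟨fun z ↦ ⟨A z ∘ (f z.2).1, (f z.2).2.comp_linearIsometryEquiv _⟩,
    Continuous.subtype_mk (continuous_pi hAc) _⟩, fun t ↦ ?_, fun t ↦ ?_, fun s t hst ↦ ?_⟩
  · refine Subtype.ext (funext fun i ↦ ?_)
    change A (0, t) _ = _
    simp [hA, v, reflection_span_add_self]
  · change A (1, t) _ = _
    simp only [hA, v, reflection_span_singleton_self]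
    simp only [Set.Icc.coe_one, sub_self, zero_smul, zero_add, one_smul]
    rw [reflection_span_add_apply_left (((f t).2.1 0).trans (hgn t).symm) (hgh t),
      reflection_span_add_apply_right (he.trans (hgn t).symm) (hge t),
      reflection_span_singleton_self]
  · refine Subtype.ext (funext fun i ↦ ?_)
    change A (s, t) _ = _
    simp [hA, hst]

end Frames

section FundamentalGroup

variable {E : Type*} [NormedAddCommGroup E] [InnerProductSpace ℝ E] {k : ℕ}

theorem frameCons_map_surjective (hE : 3 ≤ finrank ℝ E) (e : E) (he : ‖e‖ = 1)
    (y : OrthonormalFrame k (ℝ ∙ e)ᗮ) :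
    Function.Surjective (FundamentalGroup.map (frameCons k e he) y) := by
  have : FiniteDimensional ℝ E := .of_finrank_pos (by lia)
  intro p
  induction p using Path.Homotopic.Quotient.ind with | mk γ
  obtain ⟨Φ, h0, h1, hrel⟩ := exists_homotopy_first_vector_eq (F := ℝ) (by rw [finrank_self]; lia)
    ⟨((↑) : I → ℝ), continuous_subtype_val⟩ ⟨Set.projIcc 0 1 zero_le_one, continuous_projIcc⟩
    (Set.projIcc_val zero_le_one) e he γ.toContinuousMap
  obtain ⟨g, hg⟩ := exists_frameCons_eq e he (Φ.comp ⟨fun t ↦ (1, t), by fun_prop⟩) h1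
  have hs : Φ (1, 0) = frameCons k e he y := by
    rw [hrel 1 0 (by simp [frameCons_apply_zero])]; exact γ.source
  have ht : Φ (1, 1) = frameCons k e he y := by
    rw [hrel 1 1 (by simp [frameCons_apply_zero])]; exact γ.target
  refine ⟨FundamentalGroup.fromPath (.mk ⟨g, ?_, ?_⟩), ?_⟩
  · exact frameCons_injective e he ((hg 0).trans hs)
  · exact frameCons_injective e he ((hg 1).trans ht)
  · refine (Path.Homotopic.Quotient.eq.2 ⟨?_⟩ : Path.Homotopic.Quotient.mk _ = .mk γ)
    refine Path.Homotopy.symm ⟨⟨Φ, h0, fun t ↦ (hg t).symm⟩, fun s t hmem ↦ ?_⟩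
    refine hrel s t ?_
    rcases hmem with rfl | rfl <;> simp [frameCons_apply_zero]

theorem frameCons_map_injective (hE : 4 ≤ finrank ℝ E) (e : E) (he : ‖e‖ = 1)
    (y : OrthonormalFrame k (ℝ ∙ e)ᗮ) :
    Function.Injective (FundamentalGroup.map (frameCons k e he) y) := by
  have : FiniteDimensional ℝ E := .of_finrank_pos (by lia)
  intro p q hpq
  induction p using Path.Homotopic.Quotient.ind with | mk γ
  induction q using Path.Homotopic.Quotient.ind with | mk γ'
  obtain ⟨H⟩ := Path.Homotopic.Quotient.exact
    (p := γ.map (frameCons k e he).continuous) (q := γ'.map (frameCons k e he).continuous) hpq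
  let π : C(ℝ, I) := ⟨Set.projIcc 0 1 zero_le_one, continuous_projIcc⟩
  obtain ⟨Φ, -, h1, hrel⟩ := exists_homotopy_first_vector_eq (F := ℝ × ℝ)
    (by rw [finrank_prod, finrank_self]; lia)
    (K := I × I) ⟨fun z ↦ (z.1, z.2), by fun_prop⟩ (π.prodMap π)
    (fun z ↦ Prod.ext (Set.projIcc_val zero_le_one _) (Set.projIcc_val zero_le_one _))
    e he H.toContinuousMap
  obtain ⟨g, hg⟩ := exists_frameCons_eq e he (Φ.comp ⟨fun t ↦ (1, t), by fun_prop⟩) h1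
  have key : ∀ z x, H z = frameCons k e he x → g z = x := fun z x hz ↦
    frameCons_injective e he <| (hg z).trans <| (hrel 1 z (by
      change (H z).1 0 = e
      rw [hz, frameCons_apply_zero])).trans hz
  refine Path.Homotopic.Quotient.eq.2 ⟨⟨⟨g, fun t ↦ key _ _ ?_, fun t ↦ key _ _ ?_⟩,
    fun s t hmem ↦ key _ _ ?_⟩⟩
  · exact H.apply_zero t
  · exact H.apply_one t
  · exact H.eq_fst s hmem

end FundamentalGroup

section Sphere

variable {E : Type*} [NormedAddCommGroup E] [InnerProductSpace ℝ E] {k : ℕ}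

theorem exists_frameCons_eq_frame (x : OrthonormalFrame (k + 1) E) :
    ∃ y, frameCons k (x.1 0) (x.2.1 0) y = x := by
  obtain ⟨g, hg⟩ := exists_frameCons_eq (x.1 0) (x.2.1 0) (ContinuousMap.const Unit x) fun _ ↦ rfl
  exact ⟨g (), hg ()⟩

/-- One-vector frames are points of the unit sphere. -/
def sphereHomeomorphFrame (E : Type*) [NormedAddCommGroup E] [InnerProductSpace ℝ E] :
    Metric.sphere (0 : E) 1 ≃ₜ OrthonormalFrame 1 E where
  toFun u := ⟨fun _ ↦ u, fun _ ↦ mem_sphere_zero_iff_norm.1 u.2, Subsingleton.pairwise⟩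
  invFun f := ⟨f.1 0, mem_sphere_zero_iff_norm.2 (f.2.1 0)⟩
  left_inv _ := rfl
  right_inv f := Subtype.ext <| funext fun i ↦ congrArg f.1 (Subsingleton.elim 0 i)
  continuous_toFun := by fun_prop
  continuous_invFun := ((continuous_apply 0).comp continuous_subtype_val).subtype_mk _

theorem subsingleton_fundamentalGroup_frame_one (hE : 3 ≤ finrank ℝ E)
    (x : OrthonormalFrame 1 E) : Subsingleton (FundamentalGroup (OrthonormalFrame 1 E) x) := by
  have := Module.finite_of_finrank_pos (R := ℝ) (M := E) (by lia)
  obtain ⟨y, hy⟩ := exists_frameCons_eq_frame x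
  rw [← hy]
  let : Unique (OrthonormalFrame 0 (ℝ ∙ x.1 0)ᗮ) := ⟨⟨y⟩, fun _ ↦ Subsingleton.elim _ _⟩
  have : Subsingleton (FundamentalGroup (OrthonormalFrame 0 (ℝ ∙ x.1 0)ᗮ) y) := inferInstance
  exact (frameCons_map_surjective hE _ _ y).subsingleton

theorem simplyConnectedSpace_sphere (hE : 3 ≤ finrank ℝ E) :
    SimplyConnectedSpace (Metric.sphere (0 : E) 1) := by
  rw [(sphereHomeomorphFrame E).toHomotopyEquiv.simplyConnectedSpace_iff,
    simply_connected_iff_loops_nullhomotopic]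
  refine ⟨?_, fun x γ ↦ ?_⟩
  · have := isPathConnected_iff_pathConnectedSpace.1 (isPathConnected_sphere
      (one_lt_rank_of_one_lt_finrank (by lia : 1 < finrank ℝ E)) (0 : E) zero_le_one)
    exact (sphereHomeomorphFrame E).surjective.pathConnectedSpace
      (sphereHomeomorphFrame E).continuous
  · have := subsingleton_fundamentalGroup_frame_one hE x
    exact Path.Homotopic.Quotient.exact (Subsingleton.elim
      (α := FundamentalGroup (OrthonormalFrame 1 E) x) (.mk γ) (.mk (.refl x)))

end Sphere

section Quaternions

open Quaternion

/-- Conjugation by a nonzero quaternion, as a linear isometry. -/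
noncomputable def quaternionConj (q : ℍ) (hq : q ≠ 0) : ℍ →ₗᵢ[ℝ] ℍ where
  toFun a := q * a * q⁻¹
  map_add' := by intros; simp [mul_add, add_mul]
  map_smul' := by intros; simp
  norm_map' a := by
    have := norm_ne_zero_iff.2 hq
    simp only [LinearMap.coe_mk, AddHom.coe_mk, norm_mul, norm_inv]
    field_simp

/-- The standard frame `1, i, j` of quaternions. -/
def quaternionFrame : Fin 3 → ℍ := ![1, ⟨0, 1, 0, 0⟩, ⟨0, 0, 1, 0⟩]

theorem orthonormal_quaternionFrame : Orthonormal ℝ quaternionFrame := by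
  rw [orthonormal_iff_ite]
  intro i j
  change (quaternionFrame i * star (quaternionFrame j)).re = _
  rw [Quaternion.re_mul]
  simp only [Quaternion.re_star, Quaternion.imI_star, Quaternion.imJ_star, Quaternion.imK_star]
  fin_cases i <;> fin_cases j <;> simp [quaternionFrame]

/-- The frame obtained by rotating `1, i, j`. -/
noncomputable def rotatedFrame : C(Metric.sphere (0 : ℍ) 1, OrthonormalFrame 3 ℍ) where
  toFun q := ⟨quaternionConj q (ne_zero_of_mem_unit_sphere q) ∘ quaternionFrame,
    orthonormal_quaternionFrame.comp_linearIsometry _⟩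
  continuous_toFun := by
    refine Continuous.subtype_mk (continuous_pi fun i ↦ ?_) _
    have : Continuous fun q : Metric.sphere (0 : ℍ) 1 ↦ ((q⁻¹ : Metric.sphere (0 : ℍ) 1) : ℍ) :=
      continuous_subtype_val.comp continuous_inv
    exact (continuous_subtype_val.mul continuous_const).mul this

theorem exists_mul_eq_mul_of_anticommute {R : Type*} [DivisionRing R] {i j a b : R}
    (hi : i * i = -1) (hj : j * j = -1) (ha : a * a = -1) (hb : b * b = -1)
    (hij : i * j = -(j * i)) (hab : a * b = -(b * a)) :
    ∃ q : R, q ≠ 0 ∧ q * i = a * q ∧ q * j = b * q := by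
  obtain ⟨p, hp, hpi⟩ : ∃ p : R, p ≠ 0 ∧ p * i = a * p := by
    by_cases h : 1 - a * i = 0
    · have hai : a = -i := by
        have : a * (a * i) = a := by rw [← sub_eq_zero.1 h, mul_one]
        rw [← this, ← mul_assoc, ha, neg_one_mul]
      refine ⟨j, fun hj0 ↦ by simp [hj0] at hj, ?_⟩
      rw [hai, neg_mul, hij, neg_neg]
    · refine ⟨_, h, ?_⟩
      simp only [sub_mul, mul_sub, one_mul, mul_one, mul_assoc, hi]
      rw [← mul_assoc, ha]
      noncomm_ring
  obtain ⟨c, hc⟩ : ∃ c, c = p⁻¹ * b * p := ⟨_, rfl⟩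
  have hpc : p * c = b * p := by rw [hc, ← mul_assoc, mul_inv_cancel_left₀ hp]
  have hcc : c * c = -1 := by
    apply mul_left_cancel₀ hp
    rw [← mul_assoc, hpc, mul_assoc, hpc, ← mul_assoc, hb, neg_one_mul, mul_neg_one]
  have hci : c * i = -(i * c) := by
    apply mul_left_cancel₀ hp
    rw [← mul_assoc, hpc, mul_assoc, hpi, mul_neg, ← mul_assoc p, hpi, mul_assoc, hpc, ← mul_assoc,
      ← mul_assoc, hab, neg_mul, neg_neg]
  obtain ⟨r, hr, hri, hrj⟩ : ∃ r : R, r ≠ 0 ∧ r * i = i * r ∧ r * j = c * r := by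
    by_cases h : 1 - c * j = 0
    · have hcj : c = -j := by
        have : c * (c * j) = c := by rw [← sub_eq_zero.1 h, mul_one]
        rw [← this, ← mul_assoc, hcc, neg_one_mul]
      refine ⟨i, fun hi0 ↦ by simp [hi0] at hi, rfl, ?_⟩
      rw [hcj, neg_mul, hij]
    · refine ⟨_, h, ?_, ?_⟩
      · have : c * j * i = i * (c * j) := by
          rw [mul_assoc, ← neg_eq_iff_eq_neg.2 hij, mul_neg, ← mul_assoc, hci, neg_mul, neg_neg,
            mul_assoc]
        rw [sub_mul, mul_sub, this, one_mul, mul_one]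
      · simp only [sub_mul, mul_sub, one_mul, mul_one, mul_assoc, hj]
        rw [← mul_assoc, hcc]
        noncomm_ring
  refine ⟨p * r, mul_ne_zero hp hr, ?_, ?_⟩
  · rw [mul_assoc, hri, ← mul_assoc, hpi, mul_assoc]
  · rw [mul_assoc, hrj, ← mul_assoc, hpc, mul_assoc]

theorem quaternion_mul_self_of_orthogonal_one {a : ℍ} (ha : ‖a‖ = 1) (h : ⟪(1 : ℍ), a⟫ = 0) :
    a * a = -1 := by
  have hre : a.re = 0 := by simpa [Quaternion.inner_def] using h
  have hs : star a = -a := Quaternion.star_eq_neg.2 hre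
  have := Quaternion.self_mul_star a
  rw [hs, Quaternion.normSq_eq_norm_mul_self, ha] at this
  simpa [neg_eq_iff_eq_neg] using this

theorem quaternion_anticommute_of_orthogonal {a b : ℍ} (ha : ⟪(1 : ℍ), a⟫ = 0)
    (hb : ⟪(1 : ℍ), b⟫ = 0) (h : ⟪a, b⟫ = 0) : a * b = -(b * a) := by
  change (1 * star a).re = 0 at ha
  change (1 * star b).re = 0 at hb
  change (a * star b).re = 0 at h
  simp only [one_mul, Quaternion.re_star] at ha hb
  simp only [Quaternion.re_mul, Quaternion.re_star, Quaternion.imI_star, Quaternion.imJ_star,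
    Quaternion.imK_star, ha, hb] at h
  ext <;> simp only [Quaternion.re_mul, Quaternion.imI_mul, Quaternion.imJ_mul,
    Quaternion.imK_mul, Quaternion.re_neg, Quaternion.imI_neg, Quaternion.imJ_neg,
    Quaternion.imK_neg, ha, hb] <;> linarith

theorem exists_rotatedFrame_eq (f : OrthonormalFrame 3 ℍ) (hf : f.1 0 = 1) :
    ∃ q, rotatedFrame q = f := by
  have h1 : ⟪(1 : ℍ), f.1 1⟫ = 0 := hf ▸ f.2.2 (by decide)
  have h2 : ⟪(1 : ℍ), f.1 2⟫ = 0 := hf ▸ f.2.2 (by decide)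
  obtain ⟨q, hq, hqi, hqj⟩ := exists_mul_eq_mul_of_anticommute
    (i := quaternionFrame 1) (j := quaternionFrame 2)
    (quaternion_mul_self_of_orthogonal_one (orthonormal_quaternionFrame.1 1)
      (orthonormal_quaternionFrame.2 (i := 0) (j := 1) (by decide)))
    (quaternion_mul_self_of_orthogonal_one (orthonormal_quaternionFrame.1 2)
      (orthonormal_quaternionFrame.2 (i := 0) (j := 2) (by decide)))
    (quaternion_mul_self_of_orthogonal_one (f.2.1 1) h1)
    (quaternion_mul_self_of_orthogonal_one (f.2.1 2) h2)
    (quaternion_anticommute_of_orthogonal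
      (orthonormal_quaternionFrame.2 (i := 0) (j := 1) (by decide))
      (orthonormal_quaternionFrame.2 (i := 0) (j := 2) (by decide))
      (orthonormal_quaternionFrame.2 (i := 1) (j := 2) (by decide)))
    (quaternion_anticommute_of_orthogonal h1 h2 (f.2.2 (by decide)))
  have hn : ‖q‖⁻¹ ≠ 0 := inv_ne_zero (norm_ne_zero_iff.2 hq)
  refine ⟨⟨‖q‖⁻¹ • q, by simp [norm_smul, hq]⟩, Subtype.ext <| funext fun k ↦ ?_⟩
  change ‖q‖⁻¹ • q * quaternionFrame k * (‖q‖⁻¹ • q)⁻¹ = f.1 k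
  rw [mul_inv_eq_iff_eq_mul₀ (smul_ne_zero hn hq), smul_mul_assoc, mul_smul_comm]
  congr 1
  fin_cases k
  · simp [quaternionFrame, hf]
  · exact hqi
  · exact hqj

theorem quaternion_eq_coe_of_commute {q : ℍ} (hi : q * quaternionFrame 1 = quaternionFrame 1 * q)
    (hj : q * quaternionFrame 2 = quaternionFrame 2 * q) : q = (q.re : ℍ) := by
  have h1 := congrArg QuaternionAlgebra.imJ hi
  have h2 := congrArg QuaternionAlgebra.imK hi
  have h3 := congrArg QuaternionAlgebra.imK hj
  rw [Quaternion.imJ_mul, Quaternion.imJ_mul] at h1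
  rw [Quaternion.imK_mul, Quaternion.imK_mul] at h2 h3
  simp [quaternionFrame] at h1 h2 h3
  ext <;> simp <;> linarith

theorem rotatedFrame_eq_iff {p q : Metric.sphere (0 : ℍ) 1} :
    rotatedFrame p = rotatedFrame q ↔
      p⁻¹ * q ∈ Subgroup.zpowers (-1 : Metric.sphere (0 : ℍ) 1) := by
  have hp := ne_zero_of_mem_unit_sphere p
  have hq := ne_zero_of_mem_unit_sphere q
  constructor
  · intro h
    have key (k : Fin 3) :
        (p : ℍ)⁻¹ * q * quaternionFrame k = quaternionFrame k * ((p : ℍ)⁻¹ * q) := by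
      have : (p : ℍ) * quaternionFrame k * (p : ℍ)⁻¹ = q * quaternionFrame k * (q : ℍ)⁻¹ :=
        congrFun (congrArg Subtype.val h) k
      rw [eq_mul_inv_iff_mul_eq₀ hq] at this
      rw [mul_assoc, ← this]
      simp only [mul_assoc, inv_mul_cancel_left₀ hp]
    have hre := quaternion_eq_coe_of_commute (key 1) (key 2)
    have hnorm : ‖(p : ℍ)⁻¹ * q‖ = 1 := by simp
    rw [hre, Quaternion.norm_coe] at hnorm
    rcases eq_or_eq_neg_of_abs_eq hnorm with h | h
    · have : p⁻¹ * q = 1 := Subtype.ext (by simpa [h] using hre)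
      rw [this]; exact one_mem _
    · have : p⁻¹ * q = -1 := Subtype.ext (by simpa [h] using hre)
      rw [this]; exact Subgroup.mem_zpowers _
  · intro h
    have : q = p ∨ q = -p := by
      have : p⁻¹ * q = 1 ∨ p⁻¹ * q = -1 := by
        obtain ⟨m, hm⟩ := h
        rw [← hm]
        exact (Int.even_or_odd m).imp Even.neg_one_zpow Odd.neg_one_zpow
      rwa [inv_mul_eq_iff_eq_mul, inv_mul_eq_iff_eq_mul, mul_one, mul_neg_one] at this
    rcases this with rfl | rfl
    · rfl
    · refine Subtype.ext <| funext fun k ↦ ?_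
      change (p : ℍ) * quaternionFrame k * (p : ℍ)⁻¹ = -p * quaternionFrame k * (-p : ℍ)⁻¹
      rw [inv_neg, neg_mul, neg_mul_neg]

theorem card_zpowers_neg_one {G : Type*} [Group G] [HasDistribNeg G] (h : (-1 : G) ≠ 1) :
    Nat.card (Subgroup.zpowers (-1 : G)) = 2 := by
  rw [Nat.card_zpowers]
  exact orderOf_eq_prime (by simp) h

theorem finrank_orthogonal_singleton {E : Type*} [NormedAddCommGroup E] [InnerProductSpace ℝ E]
    {m : ℕ} (hE : finrank ℝ E = m + 1) {e : E} (he : ‖e‖ = 1) : finrank ℝ (ℝ ∙ e)ᗮ = m := by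
  have : Fact (finrank ℝ E = m + 1) := ⟨hE⟩
  exact Submodule.finrank_orthogonal_span_singleton (norm_ne_zero_iff.1 (by simp [he]))

theorem nonempty_fundamentalGroup_frame_two {E : Type*} [NormedAddCommGroup E]
    [InnerProductSpace ℝ E] (hE : finrank ℝ E = 3) (x : OrthonormalFrame 2 E) :
    Nonempty (FundamentalGroup (OrthonormalFrame 2 E) x ≃* Multiplicative (ZMod 2)) := by
  have := Module.finite_of_finrank_pos (R := ℝ) (M := E) (by lia)
  obtain ⟨g, hg⟩ := exists_frameCons_eq (1 : ℍ) norm_one rotatedFrame fun q ↦ by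
    change (q : ℍ) * 1 * (q : ℍ)⁻¹ = 1
    rw [mul_one, mul_inv_cancel₀ (ne_zero_of_mem_unit_sphere q)]
  let φ : (ℝ ∙ (1 : ℍ))ᗮ ≃ₗᵢ[ℝ] E := (stdOrthonormalBasis ℝ _).equiv
    (stdOrthonormalBasis ℝ E) <| finCongr <|
      (finrank_orthogonal_singleton Quaternion.finrank_eq_four norm_one).trans hE.symm
  have hsurj : Function.Surjective g := fun y ↦ by
    obtain ⟨q, hq⟩ := exists_rotatedFrame_eq (frameCons 2 1 norm_one y) rfl
    exact ⟨q, frameCons_injective _ norm_one ((hg q).trans hq)⟩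
  have hquot : Topology.IsQuotientMap g :=
    g.continuous.isClosedMap.isQuotientMap g.continuous hsurj
  have hcard := card_zpowers_neg_one (G := Metric.sphere (0 : ℍ) 1) fun h ↦ by
    have := congrArg (fun q : Metric.sphere (0 : ℍ) 1 ↦ (q : ℍ).re) h
    norm_num at this
  have := Nat.finite_of_card_ne_zero (hcard.trans_ne two_ne_zero)
  have hcov := (hquot.isQuotientCoveringMap_of_subgroupOp _ (Set.Finite.isDiscrete this)
    fun {p q} ↦ by rw [← rotatedFrame_eq_iff, ← hg, ← hg, (frameCons_injective _ _).eq_iff]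
    ).homeomorph_comp (OrthonormalFrame.congr φ)
  obtain ⟨q, hq⟩ := hcov.surjective x
  have := simplyConnectedSpace_sphere (E := ℍ) (by rw [Quaternion.finrank_eq_four]; lia)
  have e := hcov.fundamentalGroupEquiv ⟨q, hq⟩
  refine ⟨mulEquivOfPrimeCardEq (p := 2) ?_ (by simp)⟩
  rwa [Nat.card_congr e.toEquiv, Nat.card_congr MulOpposite.opEquiv.symm,
    ← Nat.card_congr (Subgroup.equivOp _)]

end Quaternions

theorem nonempty_fundamentalGroup_frame (m : ℕ) {E : Type*} [NormedAddCommGroup E]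
    [InnerProductSpace ℝ E] (hE : finrank ℝ E = m + 3) (x : OrthonormalFrame (m + 2) E) :
    Nonempty (FundamentalGroup (OrthonormalFrame (m + 2) E) x ≃* Multiplicative (ZMod 2)) := by
  induction m generalizing E with
  | zero => exact nonempty_fundamentalGroup_frame_two hE x
  | succ m ih =>
    have := Module.finite_of_finrank_pos (R := ℝ) (M := E) (by lia)
    obtain ⟨y, hy⟩ := exists_frameCons_eq_frame x
    rw [← hy]
    obtain ⟨e⟩ := ih (finrank_orthogonal_singleton hE (x.2.1 0)) y
    exact ⟨(MulEquiv.ofBijective _ ⟨frameCons_map_injective (by lia) _ (x.2.1 0) y,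
      frameCons_map_surjective (by lia) _ (x.2.1 0) y⟩).symm.trans e⟩

theorem stmt_13 (n : ℕ) (hn : 3 ≤ n)
    (x : {f : Fin (n - 1) → EuclideanSpace ℝ (Fin n) // Orthonormal ℝ f}) :
    Nonempty
      (FundamentalGroup {f : Fin (n - 1) → EuclideanSpace ℝ (Fin n) // Orthonormal ℝ f} x ≃*
        Multiplicative (ZMod 2)) := by
  obtain ⟨m, rfl⟩ := Nat.exists_eq_add_of_le' hn
  exact nonempty_fundamentalGroup_frame m finrank_euclideanSpace_fin x
end

section
/- Let m ≥ 1 and let M and N be nonempty topological m-manifolds (Hausdorff topological spaces locally homeomorphic to ℝᵐ, i.e., charted spaces over EuclideanSpace ℝ (Fin m)) with M compact and N path-connected. If τ : M → N is a continuous map that is locally injective — every point x ∈ M has a neighborhood U such that τ is injective on U — then τ is surjective: τ(M) = N. -/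
open Set Metric MeasureTheory Topology
open scoped NNReal

section
variable {E : Type*} [NormedAddCommGroup E]

theorem LipschitzWith.bijective_id_add [CompleteSpace E] {K : ℝ≥0} {g : E → E}
    (hg : LipschitzWith K g) (hK : K < 1) : Function.Bijective fun x => x + g x := by
  constructor
  · intro x y hxy
    have h1 := hg.dist_le_mul x y
    have h2 : dist (g x) (g y) = dist x y := by
      rw [dist_eq_norm, dist_eq_norm, ← norm_neg (x - y)]
      congr 1
      have : x + g x = y + g y := hxy
      rw [neg_sub, sub_eq_sub_iff_add_eq_add, add_comm (g x), this, add_comm]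
    by_contra hne
    have h3 : 0 < dist x y := dist_pos.2 hne
    have h4 : (K : ℝ) < 1 := by exact_mod_cast hK
    nlinarith
  · intro y
    have hc : ContractingWith K fun x => y - g x :=
      ⟨hK, LipschitzWith.of_dist_le_mul fun a b => by
        rw [dist_sub_left]
        exact hg.dist_le_mul a b⟩
    refine ⟨hc.fixedPoint, ?_⟩
    have := hc.fixedPoint_isFixedPt.eq
    exact (sub_eq_iff_eq_add.1 this).symm

theorem LipschitzWith.image_ball_id_add [CompleteSpace E] {K : ℝ≥0} {g : E → E}
    (hg : LipschitzWith K g) (hK : K < 1) (hzero : ∀ x, 1 ≤ ‖x‖ → g x = 0) :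
    (fun x => x + g x) '' ball 0 1 = ball 0 1 := by
  have hb := hg.bijective_id_add hK
  have hc : (fun x => x + g x) '' (ball 0 1)ᶜ = (ball 0 1)ᶜ := by
    conv_rhs => rw [← image_id (ball (0 : E) 1)ᶜ]
    refine image_congr fun x hx => ?_
    rw [hzero x (by simpa using hx), add_zero, id]
  rwa [image_compl_eq hb, compl_inj_iff] at hc

end

section
variable {E : Type*} [NormedAddCommGroup E] [NormedSpace ℝ E]

theorem lipschitzWith_of_lipschitzOnWith_closedBall {F : Type*} [NormedAddCommGroup F]
    {C : ℝ≥0} {g : E → F} (hg : LipschitzOnWith C g (closedBall 0 1))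
    (hzero : ∀ x, 1 ≤ ‖x‖ → g x = 0) : LipschitzWith C g := by
  have key : ∀ x y : E, ‖x‖ ≤ 1 → 1 ≤ ‖y‖ → dist (g x) (g y) ≤ C * dist x y := by
    intro x y hx hy
    have hcont : ContinuousOn (fun s : ℝ => ‖AffineMap.lineMap x y s‖) (Icc 0 1) := by
      fun_prop
    obtain ⟨s, hs, hs1⟩ := intermediate_value_Icc zero_le_one hcont
      (show (1 : ℝ) ∈ Icc _ _ by simp [hx, hy])
    have h1 := hg.dist_le_mul x (by simpa using hx) (AffineMap.lineMap x y s)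
      (by simpa using hs1.le)
    rw [hzero y hy, ← hzero _ hs1.ge]
    refine h1.trans ?_
    gcongr
    rw [dist_left_lineMap, Real.norm_of_nonneg hs.1]
    exact mul_le_of_le_one_left dist_nonneg hs.2
  refine LipschitzWith.of_dist_le_mul fun x y => ?_
  rcases le_total ‖x‖ 1 with hx | hx <;> rcases le_total ‖y‖ 1 with hy | hy
  · exact hg.dist_le_mul x (by simpa using hx) y (by simpa using hy)
  · exact key x y hx hy
  · rw [dist_comm, dist_comm x]
    exact key y x hy hx
  · rw [hzero x hx, hzero y hy, dist_self]
    positivity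

theorem det_one_add_pos [FiniteDimensional ℝ E] (A : E →L[ℝ] E) (hA : ‖A‖ < 1) :
    0 < (1 + A).det := by
  have hcont : ContinuousOn (fun s : ℝ => (1 + s • A).det) (Icc 0 1) := by
    have := ContinuousLinearMap.continuous_det (𝕜 := ℝ) (E := E)
    exact (this.comp (by fun_prop)).continuousOn
  by_contra! hneg
  obtain ⟨s, hs, hs0⟩ := intermediate_value_Icc' zero_le_one hcont
    (show (0 : ℝ) ∈ Icc _ _ by simpa [ContinuousLinearMap.det] using hneg)
  have hnorm : ‖-(s • A)‖ < 1 := by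
    rw [norm_neg, norm_smul, Real.norm_of_nonneg hs.1]
    exact (mul_le_of_le_one_left (norm_nonneg _) hs.2).trans_lt hA
  have hu : IsUnit (1 + s • A) := by
    simpa using isUnit_one_sub_of_norm_lt_one hnorm
  have hu' : IsUnit ((1 + s • A : E →L[ℝ] E) : E →ₗ[ℝ] E) :=
    hu.map (ContinuousLinearMap.toLinearMapRingHom : (E →L[ℝ] E) →+* (E →ₗ[ℝ] E))
  exact (LinearMap.isUnit_iff_isUnit_det _).1 hu' |>.ne_zero hs0

open Polynomial in
/-- `det (1 + A)` is an affine combination, independent of `A`, of the values of `det (1 + t A)` at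
`finrank ℝ E + 1` distinct points `t`. -/
theorem exists_det_one_add_eq_sum [FiniteDimensional ℝ E]
    {v : Fin (Module.finrank ℝ E + 1) → ℝ} (hv : Function.Injective v) :
    ∃ c : Fin (Module.finrank ℝ E + 1) → ℝ, ∑ i, c i = 1 ∧
      ∀ A : E →L[ℝ] E, (1 + A).det = ∑ i, c i * (1 + v i • A).det := by
  refine ⟨fun i => (Lagrange.basis Finset.univ v i).eval 1, ?_, fun A => ?_⟩
  · rw [← eval_finsetSum, Lagrange.sum_basis hv.injOn Finset.univ_nonempty, eval_one]
  · let b := Module.finBasis ℝ E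
    let M := LinearMap.toMatrix b b A
    let p : ℝ[X] := ((X : ℝ[X]) • M.map C + (1 : Matrix _ _ ℝ).map C).det
    have hp : ∀ t : ℝ, p.eval t = (1 + t • A).det := by
      intro t
      have h1 : LinearMap.toMatrix b b ((1 + t • A : E →L[ℝ] E) : E →ₗ[ℝ] E)
          = 1 + t • M := by
        simp [M, LinearMap.toMatrix_one]
      rw [ContinuousLinearMap.det, ← LinearMap.det_toMatrix b, h1]
      rw [eval_det]
      congr 1
      ext i j
      simp [add_comm, mul_comm]
    have hdeg : p.degree < (Finset.univ : Finset (Fin (Module.finrank ℝ E + 1))).card := by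
      rw [Finset.card_fin]
      refine degree_le_natDegree.trans_lt ?_
      have := natDegree_det_X_add_C_le M 1
      rw [Fintype.card_fin] at this
      exact_mod_cast Nat.lt_succ_of_le this
    have := Lagrange.eq_interpolate hv.injOn hdeg
    have h1 := congrArg (eval 1) this
    rw [hp, one_smul, Lagrange.interpolate_apply, eval_finsetSum] at h1
    rw [h1]
    refine Finset.sum_congr rfl fun i _ => ?_
    rw [eval_mul, eval_C, hp, mul_comm]

theorem exists_det_fderiv_id_add_ne_zero [FiniteDimensional ℝ E] {C : ℝ≥0} {g : E → E}
    (hg : LipschitzWith C g) (hzero : ∀ x, 1 ≤ ‖x‖ → g x = 0)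
    (hd : DifferentiableOn ℝ g (ball 0 1)) :
    ∃ x ∈ ball (0 : E) 1, (1 + fderiv ℝ g x).det ≠ 0 := by
  let _ : MeasurableSpace E := borel E
  have _ : BorelSpace E := ⟨rfl⟩
  let μ : Measure E := Measure.addHaar
  by_contra! hdet
  let v : Fin (Module.finrank ℝ E + 1) → ℝ := fun i => ((C + 1 : ℝ) * (i + 1 + 1))⁻¹
  have hv : Function.Injective v := by
    intro i j hij
    have h1 := mul_left_cancel₀ (by positivity) (inv_injective hij)
    have h2 : (i : ℝ) = j := by linarith
    exact Fin.ext (by exact_mod_cast h2)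
  have hv0 : ∀ i, 0 < v i := fun i => by positivity
  have hvC : ∀ i, v i * C < 1 := by
    intro i
    rw [inv_mul_lt_iff₀ (by positivity)]
    have h1 : (0 : ℝ) ≤ C := C.2
    have h2 : (0 : ℝ) ≤ i := Nat.cast_nonneg _
    nlinarith
  obtain ⟨c, hc1, hc⟩ := exists_det_one_add_eq_sum (E := E) hv
  have hlip : ∀ i, LipschitzWith (‖v i‖₊ * C) (v i • g) := fun i =>
    (lipschitzWith_smul (v i)).comp hg
  have hK : ∀ i, ‖v i‖₊ * C < 1 := by
    intro i
    rw [← NNReal.coe_lt_coe]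
    simpa [abs_of_pos (hv0 i)] using hvC i
  have hz : ∀ i x, 1 ≤ ‖x‖ → (v i • g) x = 0 := fun i x hx => by simp [hzero x hx]
  have hfd : ∀ i, ∀ x ∈ ball (0 : E) 1,
      HasFDerivWithinAt (fun x => x + (v i • g) x) (1 + v i • fderiv ℝ g x) (ball 0 1) x := by
    intro i x hx
    have h1 := (hd.differentiableAt (isOpen_ball.mem_nhds hx)).hasFDerivAt
    exact ((hasFDerivAt_id x).add (h1.const_smul (v i))).hasFDerivWithinAt
  have hpos : ∀ i x, 0 < (1 + v i • fderiv ℝ g x).det := by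
    intro i x
    refine det_one_add_pos _ ?_
    rw [norm_smul, Real.norm_of_nonneg (hv0 i).le]
    exact (mul_le_mul_of_nonneg_left (norm_fderiv_le_of_lipschitz ℝ hg) (hv0 i).le).trans_lt
      (hvC i)
  have habs : ∀ i x, |(1 + v i • fderiv ℝ g x).det| = (1 + v i • fderiv ℝ g x).det :=
    fun i x => abs_of_pos (hpos i x)
  have hinj : ∀ i, InjOn (fun x => x + (v i • g) x) (ball 0 1) := fun i =>
    ((hlip i).bijective_id_add (hK i)).injective.injOn
  have himg : ∀ i, (fun x => x + (v i • g) x) '' ball 0 1 = ball 0 1 := fun i =>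
    (hlip i).image_ball_id_add (hK i) (hz i)
  have hint : ∀ i, IntegrableOn (fun x => (1 + v i • fderiv ℝ g x).det) (ball 0 1) μ := by
    intro i
    have := (integrableOn_image_iff_integrableOn_abs_det_fderiv_smul μ measurableSet_ball
      (hfd i) (hinj i) (fun _ => (1 : ℝ))).1
      (by rw [himg i]; exact integrableOn_const measure_ball_lt_top.ne)
    simpa only [habs, smul_eq_mul, mul_one] using this
  have hval : ∀ i, ∫ x in ball 0 1, (1 + v i • fderiv ℝ g x).det ∂μ = μ.real (ball 0 1) := by
    intro i
    have := integral_image_eq_integral_abs_det_fderiv_smul μ measurableSet_ball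
      (hfd i) (hinj i) (fun _ => (1 : ℝ))
    rw [himg i] at this
    simp only [habs, smul_eq_mul, mul_one] at this
    rw [← this, setIntegral_const, smul_eq_mul, mul_one]
  have h0 : ∫ x in ball 0 1, (1 + fderiv ℝ g x).det ∂μ = 0 :=
    setIntegral_eq_zero_of_forall_eq_zero hdet
  simp only [fun x => hc (fderiv ℝ g x)] at h0
  rw [integral_finsetSum _ fun i _ => (hint i).const_mul (c i)] at h0
  simp_rw [integral_const_mul, hval, ← Finset.sum_mul, hc1, one_mul] at h0
  exact (measure_ball_pos μ (0 : E) one_pos).ne'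
    ((measureReal_eq_zero_iff measure_ball_lt_top.ne).1 h0)

end

section
variable {E : Type*} [NormedAddCommGroup E] [InnerProductSpace ℝ E] [FiniteDimensional ℝ E]

/-- A `C¹` map equal to the identity outside the open unit ball vanishes somewhere in it; otherwise
normalizing it would give a retraction of the ball onto the sphere. -/
theorem exists_eq_zero_of_contDiff_of_eq_self {F : E → E} (hF : ContDiff ℝ 1 F)
    (hself : ∀ x, 1 ≤ ‖x‖ → F x = x) : ∃ x ∈ ball (0 : E) 1, F x = 0 := by
  by_contra! hne
  have hF0 : ∀ x, F x ≠ 0 := by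
    intro x
    rcases lt_or_ge ‖x‖ 1 with hx | hx
    · exact hne x (by simpa using hx)
    · rw [hself x hx]
      exact norm_pos_iff.1 (one_pos.trans_le hx)
  let N : E → E := fun x => ‖F x‖⁻¹ • F x
  have hN : ContDiff ℝ 1 N := ((hF.norm ℝ hF0).inv fun x => norm_ne_zero_iff.2 (hF0 x)).smul hF
  have hN1 : ∀ x, ‖N x‖ = 1 := fun x => norm_smul_inv_norm (𝕜 := ℝ) (hF0 x)
  have hh : ContDiff ℝ 1 fun x => N x - x := hN.sub contDiff_id
  classical
  let g : E → E := fun x => if ‖x‖ ≤ 1 then N x - x else 0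
  have hgeq : EqOn g (fun x => N x - x) (closedBall 0 1) := fun x hx =>
    if_pos (by simpa using hx)
  have hzero : ∀ x, 1 ≤ ‖x‖ → g x = 0 := by
    intro x hx
    by_cases hx1 : ‖x‖ ≤ 1
    · have : ‖x‖ = 1 := le_antisymm hx1 hx
      simp [g, N, hself x hx, this]
    · exact if_neg hx1
  obtain ⟨C, hC⟩ := (hh.locallyLipschitz.locallyLipschitzOn (s := closedBall 0 1)
    ).exists_lipschitzOnWith_of_compact (isCompact_closedBall _ _)
  have hg : LipschitzWith C g := lipschitzWith_of_lipschitzOnWith_closedBall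
    (fun x hx y hy => by rw [hgeq hx, hgeq hy]; exact hC hx hy) hzero
  have hfd : ∀ x ∈ ball (0 : E) 1, HasFDerivAt g (fderiv ℝ N x - 1) x := by
    intro x hx
    have h1 := (hN.differentiable one_ne_zero x).hasFDerivAt.sub (hasFDerivAt_id x)
    refine h1.congr_of_eventuallyEq ?_
    filter_upwards [isOpen_ball.mem_nhds hx] with y hy using hgeq (ball_subset_closedBall hy)
  obtain ⟨x, hx, hdet⟩ := exists_det_fderiv_id_add_ne_zero hg hzero
    fun x hx => (hfd x hx).differentiableAt.differentiableWithinAt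
  rw [(hfd x hx).fderiv, add_sub_cancel] at hdet
  have hu := (LinearMap.isUnit_iff_isUnit_det ((fderiv ℝ N x : E →L[ℝ] E) : E →ₗ[ℝ] E)).2
    hdet.isUnit
  obtain ⟨w, hw⟩ := ((Module.End.isUnit_iff _).1 hu).surjective (N x)
  have hd := (hN.differentiable one_ne_zero x).hasFDerivAt.norm_sq
  have hconst : (fun y => ‖N y‖ ^ 2) = fun _ => (1 : ℝ) := by
    ext y
    rw [hN1, one_pow]
  rw [hconst] at hd
  have h0 := congrArg (fun L : E →L[ℝ] ℝ => L w) (hd.unique (hasFDerivAt_const (1 : ℝ) x))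
  have hw' : fderiv ℝ N x w = N x := hw
  simp [hw', hN1] at h0

/-- A continuous map close to the identity on the unit ball has a zero there. -/
theorem ContinuousOn.exists_eq_zero_of_norm_sub_le {u : E → E}
    (hu : ContinuousOn u (closedBall 0 1))
    (hclose : ∀ x ∈ closedBall (0 : E) 1, ‖u x - x‖ ≤ 1 / 2) :
    ∃ x ∈ closedBall (0 : E) 1, u x = 0 := by
  by_contra! hne
  have : TietzeExtension E := TietzeExtension.of_tvs ℝ
  obtain ⟨u', hu'⟩ := ContinuousMap.exists_restrict_eq (Y := E)
    (isClosed_closedBall (x := (0 : E)) (ε := 1)) ⟨_, hu.domRestrict⟩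
  have huu : ∀ x ∈ closedBall (0 : E) 1, u' x = u x := fun x hx =>
    congrArg (fun k : C(closedBall (0 : E) 1, E) => k ⟨x, hx⟩) hu'
  obtain ⟨δ, hδ, hδu⟩ : ∃ δ > 0, ∀ x ∈ closedBall (0 : E) 1, δ ≤ ‖u x‖ := by
    obtain ⟨x, hx, hmin⟩ := (isCompact_closedBall (0 : E) 1).exists_isMinOn
      ⟨0, by simp⟩ hu.norm
    exact ⟨‖u x‖, norm_pos_iff.2 (hne x hx), fun y hy => hmin hy⟩
  obtain ⟨v, hv, hvu, -⟩ := u'.continuous.exists_contDiff_approx 1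
    (ε := fun _ => min δ (1 / 4)) continuous_const (fun _ => by positivity)
  let b : ContDiffBump (0 : E) := ⟨7 / 8, 1, by norm_num, by norm_num⟩
  obtain ⟨x, hx, hx0⟩ := exists_eq_zero_of_contDiff_of_eq_self
    (F := fun x => x + b x • (v x - x))
    (contDiff_id.add (b.contDiff.smul (hv.sub contDiff_id))) (by
      intro x hx
      rw [b.zero_of_le_dist (by simpa using hx), zero_smul, add_zero])
  have hxc := ball_subset_closedBall hx
  have hvx := hvu x
  rw [huu x hxc, dist_eq_norm] at hvx
  rcases le_or_gt ‖x‖ (7 / 8) with h | h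
  · rw [b.one_of_mem_closedBall (by simpa using h), one_smul, add_sub_cancel] at hx0
    rw [hx0, zero_sub, norm_neg] at hvx
    exact (hδu x hxc).not_gt (hvx.trans_le (min_le_left _ _))
  · have h1 : ‖x‖ ≤ ‖v x - x‖ := by
      rw [eq_neg_of_add_eq_zero_left hx0, norm_neg, norm_smul, Real.norm_of_nonneg b.nonneg,
        ← eq_neg_of_add_eq_zero_left hx0]
      exact mul_le_of_le_one_left (norm_nonneg _) b.le_one
    have h2 : ‖v x - x‖ ≤ ‖v x - u x‖ + ‖u x - x‖ := norm_sub_le_norm_sub_add_norm_sub _ _ _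
    linarith [hclose x hxc, min_le_right δ (1 / 4)]

theorem image_closedBall_zero_one_mem_nhds {f : E → E} (hf : ContinuousOn f (closedBall 0 1))
    (hinj : InjOn f (closedBall 0 1)) : f '' closedBall 0 1 ∈ 𝓝 (f 0) := by
  have : TietzeExtension E := TietzeExtension.of_tvs ℝ
  have : CompactSpace (closedBall (0 : E) 1) :=
    isCompact_iff_compactSpace.1 (isCompact_closedBall _ _)
  have he : IsClosedEmbedding ((closedBall (0 : E) 1).domRestrict f) :=
    hf.domRestrict.isClosedEmbedding hinj.injective
  obtain ⟨G, hG⟩ := ContinuousMap.exists_extension' (Y := E) he ⟨_, continuous_subtype_val⟩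
  have hGf : ∀ x ∈ closedBall (0 : E) 1, G (f x) = x := fun x hx =>
    congrFun hG ⟨x, hx⟩
  have hmem0 : (0 : E) ∈ closedBall (0 : E) 1 := by simp
  obtain ⟨r, hr, hGr⟩ := Metric.continuousAt_iff.1 (G.continuous.continuousAt (x := f 0))
    (1 / 10) (by norm_num)
  rw [hGf 0 hmem0] at hGr
  simp only [dist_zero_right] at hGr
  by_contra hnhds
  obtain ⟨ε, hε, hεr⟩ : ∃ ε > 0, 2 * ε = r := ⟨r / 2, by positivity, by ring⟩
  obtain ⟨c, hc, hcK⟩ : ∃ c ∈ ball (f 0) ε, c ∉ f '' closedBall 0 1 := by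
    by_contra! h
    exact hnhds (Filter.mem_of_superset (ball_mem_nhds _ hε) h)
  rw [mem_ball, dist_comm] at hc
  have hfc : ∀ x ∈ closedBall (0 : E) 1, f x ≠ c := fun x hx h => hcK ⟨x, hx, h⟩
  obtain ⟨δ, hδ, hδG⟩ : ∃ δ > 0, ∀ x ∈ closedBall (0 : E) 1, ε ≤ dist (f x) c → δ ≤ ‖x‖ := by
    have := (hf 0 hmem0)
    rw [Metric.continuousWithinAt_iff] at this
    obtain ⟨δ, hδ, h⟩ := this (ε - dist (f 0) c) (by linarith)
    refine ⟨δ, hδ, fun x hx hxc => ?_⟩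
    by_contra! hlt
    have h1 := h hx (by simpa using hlt)
    linarith [dist_triangle (f x) (f 0) c]
  let η := min (δ / 2) (1 / 20)
  have hη : 0 < η := by positivity
  obtain ⟨P, hP, hPG, -⟩ := G.continuous.exists_contDiff_approx 1
    (ε := fun _ => η) continuous_const (fun _ => hη)
  obtain ⟨b, hb, hbP⟩ : ∃ b ∈ ball (0 : E) η, b ∉ P '' sphere c ε := by
    let _ : MeasurableSpace E := borel E
    have _ : BorelSpace E := ⟨rfl⟩
    let μ : Measure E := Measure.addHaar
    have hnull : μ (P '' sphere c ε) = 0 :=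
      addHaar_image_eq_zero_of_differentiableOn_of_addHaar_eq_zero μ
        (hP.differentiable one_ne_zero).differentiableOn
        (Measure.addHaar_sphere_of_ne_zero μ c hε.ne')
    by_contra! h
    exact (measure_ball_pos μ (0 : E) hη).ne' (measure_mono_null h hnull)
  rw [mem_ball_zero_iff] at hb
  have hPb : ∀ y, ‖P y - b - G y‖ < 2 * η := by
    intro y
    have h1 := hPG y
    rw [dist_eq_norm] at h1
    have h2 := norm_sub_le (P y - G y) b
    rw [sub_right_comm] at h2
    linarith
  let Φ : E → E := fun y => c + max (ε / ‖y - c‖) 1 • (y - c)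
  have hΦ1 : ∀ y, y ≠ c → ε ≤ dist y c → Φ y = y := by
    intro y hy h
    rw [dist_eq_norm] at h
    have : ε / ‖y - c‖ ≤ 1 := div_le_one_of_le₀ h (norm_nonneg _)
    simp [Φ, max_eq_right this]
  have hΦ2 : ∀ y, y ≠ c → dist y c < ε → Φ y ∈ sphere c ε := by
    intro y hy h
    rw [dist_eq_norm] at h
    have h0 : 0 < ‖y - c‖ := norm_pos_iff.2 (sub_ne_zero.2 hy)
    have : 1 ≤ ε / ‖y - c‖ := (one_le_div h0).2 h.le
    rw [mem_sphere, dist_eq_norm, add_sub_cancel_left, max_eq_left this, norm_smul,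
      Real.norm_of_nonneg (by positivity), div_mul_cancel₀ _ h0.ne']
  have hcont : ContinuousOn (fun x => P (Φ (f x)) - b) (closedBall 0 1) := by
    refine (hP.continuous.comp_continuousOn ?_).sub continuousOn_const
    have hfc' : ContinuousOn (fun x => f x - c) (closedBall 0 1) := hf.sub continuousOn_const
    have hdiv : ContinuousOn (fun x => ε / ‖f x - c‖) (closedBall 0 1) :=
      continuousOn_const.div hfc'.norm fun x hx =>
        norm_ne_zero_iff.2 (sub_ne_zero.2 (hfc x hx))
    exact continuousOn_const.add ((hdiv.sup continuousOn_const).smul hfc')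
  have hη1 : 2 * η ≤ δ := by linarith [min_le_left (δ / 2) (1 / 20)]
  have hη2 : 2 * η ≤ 1 / 10 := by linarith [min_le_right (δ / 2) (1 / 20)]
  obtain ⟨x, hx, hx0⟩ := hcont.exists_eq_zero_of_norm_sub_le (by
    intro x hx
    rcases le_or_gt ε (dist (f x) c) with h | h
    · have h1 := hPb (f x)
      rw [hGf x hx] at h1
      rw [hΦ1 _ (hfc x hx) h]
      linarith
    · have h1 : ‖x‖ < 1 / 10 := by
        rw [← hGf x hx]
        exact hGr (by linarith [dist_triangle_right (f x) (f 0) c])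
      have hs := hΦ2 _ (hfc x hx) h
      rw [mem_sphere] at hs
      have h2 : ‖G (Φ (f x))‖ < 1 / 10 :=
        hGr (by linarith [dist_triangle_right (Φ (f x)) (f 0) c])
      have h3 := hPb (Φ (f x))
      have h4 := norm_sub_le (P (Φ (f x)) - b) x
      have h5 := norm_le_norm_sub_add (P (Φ (f x)) - b) (G (Φ (f x)))
      linarith)
  rcases le_or_gt ε (dist (f x) c) with h | h
  · have h1 := hPb (f x)
    rw [hΦ1 _ (hfc x hx) h] at hx0
    rw [hx0, zero_sub, norm_neg, hGf x hx] at h1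
    linarith [hδG x hx h]
  · exact hbP ⟨_, hΦ2 _ (hfc x hx) h, sub_eq_zero.1 hx0⟩

/-- **Invariance of domain**, for closed balls. -/
theorem image_closedBall_mem_nhds {f : E → E} {a : E} {r : ℝ} (hr : 0 < r)
    (hf : ContinuousOn f (closedBall a r)) (hinj : InjOn f (closedBall a r)) :
    f '' closedBall a r ∈ 𝓝 (f a) := by
  have hmaps : MapsTo (fun x : E => a + r • x) (closedBall 0 1) (closedBall a r) := by
    intro x hx
    rw [mem_closedBall_zero_iff] at hx
    rw [mem_closedBall, dist_eq_norm, add_sub_cancel_left, norm_smul, Real.norm_of_nonneg hr.le]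
    exact mul_le_of_le_one_right hr.le hx
  have h := image_closedBall_zero_one_mem_nhds (f := fun x => f (a + r • x))
    (hf.comp (by fun_prop) hmaps)
    (hinj.comp (fun x _ y _ hxy => smul_right_injective E hr.ne' (add_left_cancel hxy)) hmaps)
  rw [smul_zero, add_zero] at h
  refine Filter.mem_of_superset h ?_
  rintro _ ⟨x, hx, rfl⟩
  exact ⟨_, hmaps hx, rfl⟩

theorem range_mem_nhds_of_injOn_nhds {M N : Type*} [TopologicalSpace M] [TopologicalSpace N]
    [ChartedSpace E M] [ChartedSpace E N] {τ : M → N} (hτ : Continuous τ) {x : M} {U : Set M}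
    (hU : U ∈ 𝓝 x) (hinj : InjOn τ U) : range τ ∈ 𝓝 (τ x) := by
  let φ := chartAt E x
  let ψ := chartAt E (τ x)
  have hx : x ∈ φ.source := mem_chart_source E x
  have hy : τ x ∈ ψ.source := mem_chart_source E (τ x)
  have hV : U ∩ τ ⁻¹' ψ.source ∈ 𝓝 x :=
    Filter.inter_mem hU (hτ.continuousAt.preimage_mem_nhds (ψ.open_source.mem_nhds hy))
  have hW : φ.target ∩ φ.symm ⁻¹' (U ∩ τ ⁻¹' ψ.source) ∈ 𝓝 (φ x) := by
    refine Filter.inter_mem (φ.open_target.mem_nhds (φ.map_source hx)) ?_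
    refine (φ.continuousAt_symm (φ.map_source hx)).preimage_mem_nhds ?_
    rwa [φ.left_inv hx]
  obtain ⟨r, hr, hball⟩ := Metric.nhds_basis_closedBall.mem_iff.1 hW
  have hcont : ContinuousOn (fun z => ψ (τ (φ.symm z))) (closedBall (φ x) r) :=
    ψ.continuousOn.comp (hτ.comp_continuousOn
      (φ.continuousOn_symm.mono fun z hz => (hball hz).1)) fun z hz => (hball hz).2.2
  have hinj' : InjOn (fun z => ψ (τ (φ.symm z))) (closedBall (φ x) r) := by
    intro z hz w hw hzw
    have h1 := ψ.injOn (hball hz).2.2 (hball hw).2.2 hzw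
    exact φ.symm.injOn (hball hz).1 (hball hw).1 (hinj (hball hz).2.1 (hball hw).2.1 h1)
  have himg := image_closedBall_mem_nhds hr hcont hinj'
  simp only [φ.left_inv hx] at himg
  have hpre := Filter.inter_mem (ψ.open_source.mem_nhds hy)
    ((ψ.continuousAt hy).preimage_mem_nhds himg)
  refine Filter.mem_of_superset hpre ?_
  rintro y ⟨hys, z, hz, hzy⟩
  exact ⟨φ.symm z, ψ.injOn (hball hz).2.2 hys hzy⟩

end

theorem stmt_19 (m : ℕ) (hm : 1 ≤ m)
    (M N : Type) [TopologicalSpace M] [TopologicalSpace N]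
    [T2Space M] [T2Space N]
    [ChartedSpace (EuclideanSpace ℝ (Fin m)) M]
    [ChartedSpace (EuclideanSpace ℝ (Fin m)) N]
    [Nonempty M] [Nonempty N]
    [CompactSpace M] [PathConnectedSpace N]
    (τ : M → N) (hτ : Continuous τ)
    (hloc : ∀ x : M, ∃ U ∈ nhds x, Set.InjOn τ U) :
    Function.Surjective τ := by
  have hopen : IsOpen (range τ) := by
    rw [isOpen_iff_mem_nhds]
    rintro _ ⟨x, rfl⟩
    obtain ⟨U, hU, hinj⟩ := hloc x
    exact range_mem_nhds_of_injOn_nhds (E := EuclideanSpace ℝ (Fin m)) hτ hU hinj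
  exact range_eq_univ.1
    (IsClopen.eq_univ ⟨(isCompact_range hτ).isClosed, hopen⟩ (range_nonempty τ))
end
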